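/- arXiv:1102.4229 — 9 statements merged into one kernel-verified Lean document; each statement's English description precedes it below -/
import Mathlib

section
/- As μ → 0⁺, the sum of the negative parts of the shifted two-dimensional hydrogen eigenvalues satisfies Σ_{n=0}^∞ (2n+1) · min( μ − 1/(2(n+1/2)²), 0 ) = (1/2)( ln μ − 3 ln 2 − 2γ_E + 1 ) + o(1); equivalently, Σ_{n=0}^∞ (2n+1) · min( μ − 1/(2(n+1/2)²), 0 ) − (1/2) ln μ converges to (1/2)(−3 ln 2 − 2γ_E + 1) as μ → 0⁺. -/
open Real Filter

/-- The sum of the reciprocals of the first `N` odd numbers in terms of harmonic numbers. -/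
lemma sum_two_div_odd_eq_harmonic (N : ℕ) :
    ∑ n ∈ Finset.range N, (2 : ℝ) / (2 * n + 1) = 2 * harmonic (2 * N) - harmonic N := by
  induction N with
  | zero => simp
  | succ k ih =>
    rw [Finset.sum_range_succ, ih, show 2 * (k + 1) = 2 * k + 1 + 1 by ring, harmonic_succ,
      harmonic_succ, harmonic_succ]
    push_cast
    have h1 : (2 * (k : ℝ) + 1) ≠ 0 := by positivity
    have h2 : ((k : ℝ) + 1) ≠ 0 := by positivity
    have h3 : (2 * (k : ℝ) + 1 + 1) ≠ 0 := by positivity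
    field_simp
    ring

/-- The sum of the first `N` odd numbers is `N ^ 2`. -/
lemma sum_range_odd_cast (N : ℕ) :
    ∑ n ∈ Finset.range N, (2 * (n : ℝ) + 1) = (N : ℝ) ^ 2 := by
  induction N with
  | zero => simp
  | succ k ih =>
    rw [Finset.sum_range_succ, ih]
    push_cast
    ring

/-- Exact value of the sum of the negative shifted eigenvalues, with `N = ⌊x + 1/2⌋` levels below
the threshold `μ = 1 / (2 x²)`. -/
lemma tsum_hydrogen_eq {μ x : ℝ} (hx : 0 < x) (hμ : μ = 1 / (2 * x ^ 2)) :
    ∑' n : ℕ, (2 * (n : ℝ) + 1) * min (μ - 1 / (2 * ((n : ℝ) + 1 / 2) ^ 2)) 0 =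
      μ * (⌊x + 1 / 2⌋₊ : ℝ) ^ 2 - (2 * harmonic (2 * ⌊x + 1 / 2⌋₊) - harmonic ⌊x + 1 / 2⌋₊) := by
  rw [tsum_eq_sum (s := Finset.range ⌊x + 1 / 2⌋₊), ← sum_two_div_odd_eq_harmonic,
    ← sum_range_odd_cast, Finset.mul_sum, ← Finset.sum_sub_distrib]
  · refine Finset.sum_congr rfl fun n hn => ?_
    have hn' : (n : ℝ) + 1 ≤ x + 1 / 2 := by
      have := (Nat.le_floor_iff (by positivity)).1 (Nat.succ_le_of_lt (Finset.mem_range.1 hn))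
      exact_mod_cast this
    have hle : μ ≤ 1 / (2 * ((n : ℝ) + 1 / 2) ^ 2) := by
      rw [hμ]
      gcongr
      linarith
    rw [min_eq_left (by linarith)]
    have h1 : (2 * (n : ℝ) + 1) ≠ 0 := by positivity
    have h2 : (n : ℝ) + 1 / 2 = (2 * n + 1) / 2 := by ring
    rw [h2]
    field_simp
  · intro n hn
    have hn' : x + 1 / 2 < (n : ℝ) + 1 := by
      have := Nat.lt_of_floor_lt (Nat.lt_succ_of_le (not_lt.1 (mt Finset.mem_range.2 hn)))
      exact_mod_cast this
    have hle : 1 / (2 * ((n : ℝ) + 1 / 2) ^ 2) ≤ μ := by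
      rw [hμ]
      gcongr
      linarith
    rw [min_eq_right (by linarith), mul_zero]

/-- Rounding to the nearest natural number is asymptotic to the identity. -/
lemma tendsto_nat_floor_add_half_div :
    Tendsto (fun x : ℝ => (⌊x + 1 / 2⌋₊ : ℝ) / x) atTop (nhds 1) := by
  have hinv : Tendsto (fun x : ℝ => 1 / 2 * x⁻¹) atTop (nhds 0) := by
    simpa using tendsto_inv_atTop_zero.const_mul (1 / 2 : ℝ)
  refine tendsto_of_tendsto_of_tendsto_of_le_of_le' (by simpa using hinv.const_sub 1)
    (by simpa using hinv.const_add 1) ?_ ?_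
  · filter_upwards [eventually_gt_atTop 0] with x hx
    have := Nat.lt_floor_add_one (x + 1 / 2)
    rw [le_div_iff₀ hx, sub_mul, mul_assoc, inv_mul_cancel₀ hx.ne']
    linarith
  · filter_upwards [eventually_gt_atTop 0] with x hx
    have := Nat.floor_le (show 0 ≤ x + 1 / 2 by positivity)
    rw [div_le_iff₀ hx, add_mul, mul_assoc, inv_mul_cancel₀ hx.ne']
    linarith

/-- **Two-dimensional hydrogen semiclassics.** As `μ → 0⁺`,
`∑_{n=0}^∞ (2n+1) min(μ − 1/(2(n+1/2)²), 0) = (1/2)(ln μ − 3 ln 2 − 2γ_E + 1) + o(1)`;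
i.e. the difference with `(1/2) ln μ` tends to `(1/2)(−3 ln 2 − 2γ_E + 1)`. -/
theorem hydrogen_negative_eigenvalue_sum_asymptotics :
    Tendsto (fun μ : ℝ =>
        (∑' n : ℕ, (2 * (n : ℝ) + 1) * min (μ - 1 / (2 * ((n : ℝ) + 1 / 2) ^ 2)) 0)
          - (1 / 2) * Real.log μ)
      (nhdsWithin 0 (Set.Ioi 0))
      (nhds ((1 / 2) * (-3 * Real.log 2 - 2 * Real.eulerMascheroniConstant + 1))) := by
  have hx : Tendsto (fun μ : ℝ => √(μ⁻¹ / 2)) (nhdsWithin 0 (Set.Ioi 0)) atTop :=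
    tendsto_sqrt_atTop.comp (tendsto_inv_nhdsGT_zero.atTop_div_const two_pos)
  have hN : Tendsto (fun x : ℝ => ⌊x + 1 / 2⌋₊) atTop atTop :=
    tendsto_nat_floor_atTop.comp (tendsto_atTop_add_const_right _ _ tendsto_id)
  have h2N : Tendsto (fun x : ℝ => 2 * ⌊x + 1 / 2⌋₊) atTop atTop :=
    hN.const_mul_atTop' two_pos
  have hH := tendsto_harmonic_sub_log.comp hN
  have hH2 := tendsto_harmonic_sub_log.comp h2N
  have hr := tendsto_nat_floor_add_half_div
  have hlog := hr.log one_ne_zero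
  have key := (((((hr.pow 2).const_mul (1 / 2)).sub (hH2.const_mul 2)).add hH).sub hlog).sub_const
    (3 / 2 * Real.log 2)
  have hval : 1 / 2 * (1 : ℝ) ^ 2 - 2 * eulerMascheroniConstant + eulerMascheroniConstant -
      Real.log 1 - 3 / 2 * Real.log 2 =
      (1 / 2) * (-3 * Real.log 2 - 2 * Real.eulerMascheroniConstant + 1) := by
    rw [Real.log_one]
    ring
  rw [hval] at key
  refine (key.comp hx).congr' ?_
  filter_upwards [self_mem_nhdsWithin, (hN.comp hx).eventually_ge_atTop 1] with μ hμ hN1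
  have hμ0 : 0 < μ := hμ
  simp only [Function.comp_apply] at hN1 ⊢
  have hx0 : 0 < √(μ⁻¹ / 2) := by positivity
  have hμx : μ = 1 / (2 * √(μ⁻¹ / 2) ^ 2) := by
    rw [Real.sq_sqrt (by positivity)]
    field_simp
  rw [tsum_hydrogen_eq hx0 hμx]
  generalize √(μ⁻¹ / 2) = x at *
  generalize ⌊x + 1 / 2⌋₊ = N at *
  have hN0 : (N : ℝ) ≠ 0 := by positivity
  have hlogμ : Real.log μ = -(Real.log 2 + 2 * Real.log x) := by
    rw [hμx, one_div, Real.log_inv, Real.log_mul two_ne_zero (by positivity), Real.log_pow]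
    norm_num
  have hsq : μ * (N : ℝ) ^ 2 = 1 / 2 * ((N : ℝ) / x) ^ 2 := by
    rw [hμx]
    field_simp
  rw [hlogμ, hsq, Real.log_div hN0 hx0.ne']
  push_cast
  rw [Real.log_mul two_ne_zero hN0]
  ring
end

section
/- Let ρ : ℝ² → [0, ∞) be measurable, radially symmetric (ρ(x) depends only on |x|), integrable, and satisfy ρ(x) ≤ (2π|x|)^{-1} for a.e. x ≠ 0. Then for every x ∈ ℝ² ∖ {0}, the Coulomb potential satisfies the lower bound ∫_{ℝ²} ρ(y)/|x − y| dy ≥ ∫_{ℝ²} ρ(y)/max{|x|, |y|} dy. -/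
open Real MeasureTheory ENNReal

/-- The norm of a circle average is at most the average of the norms, in `lintegral` form and
without any integrability assumption. -/
theorem enorm_circleAverage_mul_le_lintegral (f : ℂ → ℂ) (r : ℝ) :
    ENNReal.ofReal (2 * π) * ‖circleAverage f 0 r‖ₑ
      ≤ ∫⁻ θ in Set.Ioo (-π) π, ‖f (circleMap 0 r θ)‖ₑ := by
  have hpi : (0 : ℝ) < 2 * π := by positivity
  have h : ((2 * π : ℝ) : ℂ) * circleAverage f 0 r
      = ∫ θ in Set.Ioo (-π) π, f (circleMap 0 r θ) := by
    have hper : Function.Periodic (fun θ ↦ f (circleMap 0 r θ)) (2 * π) := fun θ ↦ by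
      simp only [periodic_circleMap 0 r θ]
    have hshift := hper.intervalIntegral_add_eq 0 (-π)
    rw [zero_add, show -π + 2 * π = π by ring] at hshift
    rw [circleAverage_def, hshift, intervalIntegral.integral_of_le (by linarith),
      integral_Ioc_eq_integral_Ioo, Complex.real_smul, ← mul_assoc, ← Complex.ofReal_mul,
      mul_inv_cancel₀ hpi.ne', Complex.ofReal_one, one_mul]
  calc ENNReal.ofReal (2 * π) * ‖circleAverage f 0 r‖ₑ
      = ‖((2 * π : ℝ) : ℂ) * circleAverage f 0 r‖ₑ := by
        rw [enorm_mul, ← ofReal_norm (((2 * π : ℝ) : ℂ)), Complex.norm_of_nonneg hpi.le]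
    _ ≤ _ := by
        rw [h]
        exact enorm_integral_le_lintegral_enorm _

/-- The average of `1 / |w - ·|` over a circle of radius `r` about the origin is at least
`1 / max |w| r`. -/
theorem inv_max_norm_le_lintegral_circle {w : ℂ} {r : ℝ} (hr : 0 < r) (hrw : r ≠ ‖w‖) :
    ENNReal.ofReal (2 * π) * ENNReal.ofReal (max ‖w‖ r)⁻¹
      ≤ ∫⁻ θ in Set.Ioo (-π) π, ENNReal.ofReal ‖w - circleMap 0 r θ‖⁻¹ := by
  rcases lt_or_gt_of_ne hrw with h | h
  · have hne : ∀ z ∈ Metric.closedBall (0 : ℂ) |r|, w - z ≠ 0 := by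
      intro z hz hwz
      rw [mem_closedBall_zero_iff, abs_of_pos hr, ← sub_eq_zero.1 hwz] at hz
      linarith
    have hav : circleAverage (fun z ↦ (w - z)⁻¹) 0 r = w⁻¹ := by
      have hd : DifferentiableOn ℂ (fun z ↦ (w - z)⁻¹) (Metric.closedBall 0 |r|) :=
        DifferentiableOn.fun_inv (by fun_prop) hne
      simpa using (hd.diffContOnCl_ball subset_rfl).circleAverage
    have key := enorm_circleAverage_mul_le_lintegral (fun z ↦ (w - z)⁻¹) r
    rw [hav] at key
    simpa only [← ofReal_norm, norm_inv, max_eq_left h.le] using key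
  · have hav : circleAverage (fun z ↦ z / (z - w)) 0 r = 1 := by
      have := DiffContOnCl.circleAverage_smul_div (c := 0) (R := r) (w := w)
        (f := fun _ : ℂ ↦ (1 : ℂ)) diffContOnCl_const (by simpa [abs_of_pos hr] using h)
      simpa using this
    have key := enorm_circleAverage_mul_le_lintegral (fun z ↦ z / (z - w)) r
    have hmul : ∀ θ, ‖circleMap 0 r θ / (circleMap 0 r θ - w)‖ₑ
        = ENNReal.ofReal r * ENNReal.ofReal ‖w - circleMap 0 r θ‖⁻¹ := fun θ ↦ by
      rw [← ofReal_norm, norm_div, norm_sub_rev, norm_circleMap_zero, abs_of_pos hr,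
        div_eq_mul_inv, ENNReal.ofReal_mul hr.le]
    simp only [hav, hmul, enorm_one, mul_one] at key
    rw [lintegral_const_mul' _ _ ENNReal.ofReal_ne_top] at key
    rw [max_eq_right h.le, ENNReal.ofReal_inv_of_pos hr, mul_comm]
    calc (ENNReal.ofReal r)⁻¹ * ENNReal.ofReal (2 * π) ≤ (ENNReal.ofReal r)⁻¹ *
          (ENNReal.ofReal r * ∫⁻ θ in Set.Ioo (-π) π, ENNReal.ofReal ‖w - circleMap 0 r θ‖⁻¹) := by
          gcongr
      _ = _ := by
        rw [← mul_assoc, ENNReal.inv_mul_cancel (by simpa using hr) ENNReal.ofReal_ne_top, one_mul]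

/-- Polar coordinates for the lower Lebesgue integral on `ℂ`, as an iterated integral. -/
theorem Complex.lintegral_eq_lintegral_circleMap {f : ℂ → ℝ≥0∞} (hf : Measurable f) :
    ∫⁻ z, f z = ∫⁻ r in Set.Ioi (0 : ℝ), ENNReal.ofReal r *
      ∫⁻ θ in Set.Ioo (-π) π, f (circleMap 0 r θ) := by
  have hsymm : ∀ p : ℝ × ℝ, Complex.polarCoord.symm p = circleMap 0 p.1 p.2 := fun p ↦ by
    rw [Complex.polarCoord_symm_apply, circleMap_zero, Complex.exp_mul_I]
    push_cast
    rfl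
  have hcm : Measurable fun p : ℝ × ℝ ↦ circleMap 0 p.1 p.2 := by
    simp only [circleMap_zero]
    fun_prop
  rw [← Complex.lintegral_comp_polarCoord_symm, polarCoord_target, Measure.volume_eq_prod,
    ← Measure.prod_restrict]
  simp only [hsymm, smul_eq_mul]
  rw [lintegral_prod _ (by fun_prop)]
  exact lintegral_congr fun r ↦ lintegral_const_mul' _ _ ENNReal.ofReal_ne_top

/-- The Coulomb potential lower bound for radial densities on `ℂ`. -/
theorem Complex.lintegral_div_max_norm_le_of_radial {ρ : ℂ → ℝ} (hmeas : Measurable ρ)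
    (hnonneg : ∀ z, 0 ≤ ρ z) (hrad : ∀ z z' : ℂ, ‖z‖ = ‖z'‖ → ρ z = ρ z') (w : ℂ) :
    ∫⁻ z, ENNReal.ofReal (ρ z / max ‖w‖ ‖z‖) ≤ ∫⁻ z, ENNReal.ofReal (ρ z / ‖w - z‖) := by
  rw [Complex.lintegral_eq_lintegral_circleMap (by fun_prop),
    Complex.lintegral_eq_lintegral_circleMap (by fun_prop)]
  refine lintegral_mono_ae ?_
  filter_upwards [ae_restrict_mem measurableSet_Ioi, Measure.ae_ne _ ‖w‖] with r hr hrw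
  have hr : 0 < r := hr
  have hρ : ∀ θ, ρ (circleMap 0 r θ) = ρ r := fun θ ↦ hrad _ _ (by simp)
  simp only [hρ, norm_circleMap_zero, abs_of_pos hr, div_eq_mul_inv,
    ENNReal.ofReal_mul (hnonneg _)]
  rw [setLIntegral_const, lintegral_const_mul' _ _ ENNReal.ofReal_ne_top, Real.volume_Ioo,
    show π - -π = 2 * π by ring, mul_assoc, mul_comm (ENNReal.ofReal (max _ _)⁻¹)]
  gcongr
  exact inv_max_norm_le_lintegral_circle hr hrw

/-- **Coulomb potential lower bound.** If `ρ : ℝ² → [0,∞)` is measurable, radially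
symmetric, integrable, and `ρ(x) ≤ (2π|x|)⁻¹` a.e., then for every `x ≠ 0`,
`∫ ρ(y)/|x − y| dy ≥ ∫ ρ(y)/max{|x|,|y|} dy`. -/
theorem coulomb_potential_lower_bound
    (ρ : EuclideanSpace ℝ (Fin 2) → ℝ)
    (hmeas : Measurable ρ)
    (hnonneg : ∀ x, 0 ≤ ρ x)
    (hrad : ∀ x y : EuclideanSpace ℝ (Fin 2), ‖x‖ = ‖y‖ → ρ x = ρ y)
    (hint : Integrable ρ)
    (hbound : ∀ᵐ x : EuclideanSpace ℝ (Fin 2), ρ x ≤ (2 * Real.pi * ‖x‖)⁻¹) :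
    ∀ x : EuclideanSpace ℝ (Fin 2), x ≠ 0 →
      (∫⁻ y : EuclideanSpace ℝ (Fin 2), ENNReal.ofReal (ρ y / ‖x - y‖))
        ≥ ∫⁻ y : EuclideanSpace ℝ (Fin 2), ENNReal.ofReal (ρ y / max ‖x‖ ‖y‖) := by
  intro x _
  let e := Complex.orthonormalBasisOneI.repr
  have key := Complex.lintegral_div_max_norm_le_of_radial (ρ := ρ ∘ e)
    (hmeas.comp e.continuous.measurable) (fun z ↦ hnonneg _)
    (fun z z' h ↦ hrad _ _ (by simpa using h)) (e.symm x)
  have hnorm : ∀ z, ‖e.symm x - z‖ = ‖x - e z‖ := fun z ↦ by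
    rw [← e.norm_map, map_sub, e.apply_symm_apply]
  simp only [hnorm, Function.comp_apply, e.symm.norm_map, ← e.norm_map] at key
  rwa [e.measurePreserving.lintegral_comp_emb e.toMeasurableEquiv.measurableEmbedding
      (fun y ↦ ENNReal.ofReal (ρ y / ‖x - y‖)),
    e.measurePreserving.lintegral_comp_emb e.toMeasurableEquiv.measurableEmbedding
      (fun y ↦ ENNReal.ofReal (ρ y / max ‖x‖ ‖y‖))] at key
end

section
/- Let ρ : ℝ² → [0, ∞) be measurable, radially symmetric, with ρ(x) ≤ (2π|x|)^{-1} for a.e. x ≠ 0 and ∫_{ℝ²} ρ = λ. Then for every x ∈ ℝ² ∖ {0}, ∫_{ℝ²} ρ(y)/|x − y| dy ≤ 2√(2λ) |x|^{-1/2} + 3. -/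
open Real MeasureTheory ENNReal

/-- The radial profile `(2π)⁻¹ / (a t)` for `t ≤ a`, and `(2π)⁻¹ C / t³` for `t > a`. -/
noncomputable def radialMajorant (a C t : ℝ) : ℝ :=
  (2 * Real.pi)⁻¹ * if t ≤ a then (a * t)⁻¹ else C * (t ^ 3)⁻¹

lemma radialMajorant_nonneg {a C t : ℝ} (ha : 0 < a) (hC : 0 ≤ C) (ht : 0 ≤ t) :
    0 ≤ radialMajorant a C t := by
  unfold radialMajorant
  split_ifs <;> positivity

lemma mul_radialMajorant_of_le {a C t : ℝ} (ht : 0 < t) (hta : t ≤ a) :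
    t * radialMajorant a C t = (2 * Real.pi)⁻¹ * a⁻¹ := by
  have := ht.trans_le hta
  rw [radialMajorant, if_pos hta]
  field_simp

lemma mul_radialMajorant_of_lt {a C t : ℝ} (ha : 0 < a) (hat : a < t) :
    t * radialMajorant a C t = (2 * Real.pi)⁻¹ * C * t ^ (-2 : ℝ) := by
  have := ha.trans hat
  rw [radialMajorant, if_neg hat.not_ge, Real.rpow_neg this.le, Real.rpow_two]
  field_simp

lemma integrableOn_mul_radialMajorant_Ioc {a : ℝ} (C : ℝ) :
    IntegrableOn (fun t ↦ t * radialMajorant a C t) (Set.Ioc 0 a) := by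
  refine IntegrableOn.congr_fun (f := fun _ ↦ (2 * Real.pi)⁻¹ * a⁻¹) ?_
    (fun t ht ↦ (mul_radialMajorant_of_le ht.1 ht.2).symm) measurableSet_Ioc
  exact integrableOn_const (by simp)

lemma integrableOn_mul_radialMajorant_Ioi {a : ℝ} (C : ℝ) (ha : 0 < a) :
    IntegrableOn (fun t ↦ t * radialMajorant a C t) (Set.Ioi a) := by
  refine IntegrableOn.congr_fun (f := fun t ↦ (2 * Real.pi)⁻¹ * C * t ^ (-2 : ℝ)) ?_
    (fun t ht ↦ (mul_radialMajorant_of_lt ha ht).symm) measurableSet_Ioi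
  exact (integrableOn_Ioi_rpow_of_lt (by norm_num) ha).const_mul _

lemma integrable_radialMajorant_norm {a : ℝ} (C : ℝ) (ha : 0 < a) :
    Integrable (fun y : EuclideanSpace ℝ (Fin 2) ↦ radialMajorant a C ‖y‖) := by
  rw [integrable_fun_norm_addHaar volume (f := radialMajorant a C),
    ← Set.Ioc_union_Ioi_eq_Ioi ha.le]
  simpa using (integrableOn_mul_radialMajorant_Ioc C).union
    (integrableOn_mul_radialMajorant_Ioi C ha)

lemma integral_radialMajorant_norm {a : ℝ} (C : ℝ) (ha : 0 < a) :
    ∫ y : EuclideanSpace ℝ (Fin 2), radialMajorant a C ‖y‖ = 1 + C / a := by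
  have h₁ : ∫ t in Set.Ioc 0 a, t * radialMajorant a C t = (2 * Real.pi)⁻¹ := by
    rw [setIntegral_congr_fun measurableSet_Ioc
      (fun t ht ↦ mul_radialMajorant_of_le (C := C) ht.1 ht.2)]
    simp [ha.le]
    field_simp
  have h₂ : ∫ t in Set.Ioi a, t * radialMajorant a C t = (2 * Real.pi)⁻¹ * C * a⁻¹ := by
    rw [setIntegral_congr_fun measurableSet_Ioi
      (fun t ht ↦ mul_radialMajorant_of_lt (C := C) ha ht), integral_const_mul,
      integral_Ioi_rpow_of_lt (by norm_num) ha]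
    norm_num [Real.rpow_neg_one]
  have h₃ : ∫ t in Set.Ioi 0, t * radialMajorant a C t
      = (2 * Real.pi)⁻¹ + (2 * Real.pi)⁻¹ * C * a⁻¹ := by
    rw [← Set.Ioc_union_Ioi_eq_Ioi ha.le, setIntegral_union (Set.Ioc_disjoint_Ioi le_rfl)
      measurableSet_Ioi (integrableOn_mul_radialMajorant_Ioc C)
      (integrableOn_mul_radialMajorant_Ioi C ha), h₁, h₂]
  have hball : volume.real (Metric.ball (0 : EuclideanSpace ℝ (Fin 2)) 1) = Real.pi := by
    simp [Measure.real, Real.pi_nonneg]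
  rw [integral_fun_norm_addHaar volume (radialMajorant a C), hball]
  simp only [finrank_euclideanSpace_fin, Nat.add_one_sub_one, pow_one, smul_eq_mul, h₃,
    nsmul_eq_mul]
  push_cast
  field_simp

/-- A density value `p ≤ (2πu)⁻¹`, divided by `v`, is controlled by the radial majorants at the two
distances `u`, `v` whenever these add up to at least `2a`. -/
lemma div_le_add_radialMajorant {p u v a ε : ℝ} (hp : 0 ≤ p) (hu : 0 < u) (hv : 0 < v)
    (ha : 0 < a) (hε : 0 < ε) (huv : 2 * a ≤ u + v) (hpu : p ≤ (2 * Real.pi * u)⁻¹) :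
    p / v ≤ ε / 2 * p + (radialMajorant a (2 * ε)⁻¹ u + radialMajorant a (2 * ε)⁻¹ v) := by
  have hC : 0 ≤ (2 * ε)⁻¹ := by positivity
  have hu' := radialMajorant_nonneg ha hC hu.le
  have hv' := radialMajorant_nonneg ha hC hv.le
  have hεp : 0 ≤ ε / 2 * p := by positivity
  have hle : p / v ≤ (2 * Real.pi)⁻¹ * (u * v)⁻¹ := by
    rw [div_eq_mul_inv, mul_inv u, ← mul_assoc, ← mul_inv]
    gcongr
  by_cases hua : u ≤ a
  · have : (2 * Real.pi)⁻¹ * (u * v)⁻¹ ≤ radialMajorant a (2 * ε)⁻¹ u := by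
      rw [radialMajorant, if_pos hua, mul_comm u v]
      gcongr
      linarith
    linarith
  by_cases hva : v ≤ a
  · have : (2 * Real.pi)⁻¹ * (u * v)⁻¹ ≤ radialMajorant a (2 * ε)⁻¹ v := by
      rw [radialMajorant, if_pos hva]
      gcongr
      linarith
    linarith
  have hamgm : p / v ≤ ε / 2 * p + (2 * ε)⁻¹ * (p / v ^ 2) := by
    have : 0 ≤ p * (ε - v⁻¹) ^ 2 / (2 * ε) := by positivity
    have h : p * (ε - v⁻¹) ^ 2 / (2 * ε)
        = ε / 2 * p + (2 * ε)⁻¹ * (p / v ^ 2) - p / v := by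
      field_simp
      ring
    linarith
  have hcube : p / v ^ 2 ≤ (2 * Real.pi)⁻¹ * (u * v ^ 2)⁻¹ := by
    rw [div_eq_mul_inv, mul_inv u, ← mul_assoc, ← mul_inv]
    gcongr
  have hfar : (2 * ε)⁻¹ * (p / v ^ 2)
      ≤ radialMajorant a (2 * ε)⁻¹ u + radialMajorant a (2 * ε)⁻¹ v := by
    refine (mul_le_mul_of_nonneg_left hcube hC).trans ?_
    rw [mul_left_comm]
    rcases le_total u v with h | h
    · refine le_add_of_le_of_nonneg ?_ hv'
      rw [radialMajorant, if_neg hua, pow_succ' u 2]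
      gcongr
    · refine le_add_of_nonneg_of_le hu' ?_
      rw [radialMajorant, if_neg hva, pow_succ' v 2]
      gcongr
  linarith

lemma lintegral_coulomb_le {ρ : EuclideanSpace ℝ (Fin 2) → ℝ}
    (hnonneg : ∀ x, 0 ≤ ρ x) (hint : Integrable ρ)
    (hbound : ∀ᵐ x : EuclideanSpace ℝ (Fin 2), ρ x ≤ (2 * Real.pi * ‖x‖)⁻¹)
    {x : EuclideanSpace ℝ (Fin 2)} (hx : x ≠ 0) {ε : ℝ} (hε : 0 < ε) :
    (∫⁻ y, ENNReal.ofReal (ρ y / ‖x - y‖))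
      ≤ ENNReal.ofReal (ε / 2 * (∫ y, ρ y) + (2 + 2 / (ε * ‖x‖))) := by
  have hr : 0 < ‖x‖ := norm_pos_iff.mpr hx
  have ha : 0 < ‖x‖ / 2 := by positivity
  have hC : 0 ≤ (2 * ε)⁻¹ := by positivity
  have hρi : Integrable fun y ↦ ε / 2 * ρ y := hint.const_mul _
  have hu := integrable_radialMajorant_norm (2 * ε)⁻¹ ha
  have hv := hu.comp_sub_left x
  have huv : Integrable fun y ↦ radialMajorant (‖x‖ / 2) (2 * ε)⁻¹ ‖y‖
      + radialMajorant (‖x‖ / 2) (2 * ε)⁻¹ ‖x - y‖ := hu.add hv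
  have hsum : Integrable fun y ↦ ε / 2 * ρ y + (radialMajorant (‖x‖ / 2) (2 * ε)⁻¹ ‖y‖
      + radialMajorant (‖x‖ / 2) (2 * ε)⁻¹ ‖x - y‖) := hρi.add huv
  have hint_eq : ∫ y, (ε / 2 * ρ y + (radialMajorant (‖x‖ / 2) (2 * ε)⁻¹ ‖y‖
      + radialMajorant (‖x‖ / 2) (2 * ε)⁻¹ ‖x - y‖))
      = ε / 2 * (∫ y, ρ y) + (2 + 2 / (ε * ‖x‖)) := by
    rw [integral_add hρi huv, integral_add hu hv, integral_const_mul,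
      integral_sub_left_eq_self (fun y ↦ radialMajorant (‖x‖ / 2) (2 * ε)⁻¹ ‖y‖) volume x,
      integral_radialMajorant_norm _ ha]
    field_simp
    ring
  rw [← hint_eq, ofReal_integral_eq_lintegral_ofReal hsum]
  · refine lintegral_mono_ae ?_
    filter_upwards [hbound, Measure.ae_ne volume 0, Measure.ae_ne volume x] with y hy hy0 hyx
    refine ENNReal.ofReal_le_ofReal (div_le_add_radialMajorant (hnonneg y)
      (norm_pos_iff.mpr hy0) (norm_pos_iff.mpr (sub_ne_zero.mpr hyx.symm)) ha hε ?_ hy)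
    have := norm_add_le y (x - y)
    rw [add_sub_cancel] at this
    linarith
  · refine .of_forall fun y ↦ ?_
    have := hnonneg y
    have := radialMajorant_nonneg ha hC (norm_nonneg y)
    have := radialMajorant_nonneg ha hC (norm_nonneg (x - y))
    dsimp
    positivity

/-- **Coulomb potential upper bound.** If `ρ : ℝ² → [0,∞)` is measurable, radially
symmetric, `ρ(x) ≤ (2π|x|)⁻¹` a.e. and `∫ ρ = λ`, then for every `x ≠ 0`,
`∫ ρ(y)/|x − y| dy ≤ 2√(2λ)|x|^{-1/2} + 3`. -/
theorem coulomb_potential_upper_bound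
    (ρ : EuclideanSpace ℝ (Fin 2) → ℝ) (lam : ℝ)
    (hmeas : Measurable ρ)
    (hnonneg : ∀ x, 0 ≤ ρ x)
    (hrad : ∀ x y : EuclideanSpace ℝ (Fin 2), ‖x‖ = ‖y‖ → ρ x = ρ y)
    (hint : Integrable ρ)
    (hmass : ∫ x : EuclideanSpace ℝ (Fin 2), ρ x = lam)
    (hbound : ∀ᵐ x : EuclideanSpace ℝ (Fin 2), ρ x ≤ (2 * Real.pi * ‖x‖)⁻¹) :
    ∀ x : EuclideanSpace ℝ (Fin 2), x ≠ 0 →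
      (∫⁻ y : EuclideanSpace ℝ (Fin 2), ENNReal.ofReal (ρ y / ‖x - y‖))
        ≤ ENNReal.ofReal (2 * Real.sqrt (2 * lam) * ‖x‖ ^ (-(1/2) : ℝ) + 3) := by
  intro x hx
  have hr : 0 < ‖x‖ := norm_pos_iff.mpr hx
  have hlam : 0 ≤ lam := hmass ▸ integral_nonneg hnonneg
  rcases hlam.eq_or_lt with rfl | hpos
  · refine (lintegral_coulomb_le hnonneg hint hbound hx (ε := 2 / ‖x‖) (by positivity)).trans
      (ENNReal.ofReal_le_ofReal ?_)
    rw [hmass]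
    field_simp
    norm_num
  · have hs : 0 < √lam := Real.sqrt_pos.mpr hpos
    have ht : 0 < √‖x‖ := Real.sqrt_pos.mpr hr
    refine (lintegral_coulomb_le hnonneg hint hbound hx (ε := 2 / (√lam * √‖x‖))
      (by positivity)).trans (ENNReal.ofReal_le_ofReal ?_)
    rw [hmass, Real.rpow_neg hr.le, ← Real.sqrt_eq_rpow]
    have hsum : 2 / (√lam * √‖x‖) / 2 * lam + (2 + 2 / (2 / (√lam * √‖x‖) * ‖x‖))
        = 2 * √lam * (√‖x‖)⁻¹ + 2 := by
      have h₁ : √lam ^ 2 = lam := Real.sq_sqrt hlam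
      have h₂ : √‖x‖ ^ 2 = ‖x‖ := Real.sq_sqrt hr.le
      generalize √lam = s at *
      generalize √‖x‖ = t at *
      rw [← h₁, ← h₂]
      field_simp
      ring
    rw [hsum]
    have hle : √lam ≤ √(2 * lam) := Real.sqrt_le_sqrt (by linarith)
    gcongr
    norm_num
end

section
/- There exists a universal constant C₁ > 0 with the following property. Let ρ : ℝ² → [0, ∞) be measurable, radially symmetric, with ρ(x) ≤ (2π|x|)^{-1} for a.e. x ≠ 0 and ∫_{ℝ²} ρ = λ. Then for every δ > 0 there exists R > 0 (depending on ρ and δ) such that for all x with |x| ≥ R, ∫_{ℝ²} ρ(y)/|x − y| dy ≤ (λ + δ)/|x| + C₁ (ln|x| / |x|) ∫_{|x|/2 ≤ |y| ≤ 3|x|/2} ρ(y) dy. -/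
open Real MeasureTheory ENNReal

theorem lintegral_polarCoord_target_mul {g h : ℝ → ℝ≥0∞} (hg : Measurable g) (hh : Measurable h) :
    ∫⁻ p in polarCoord.target, ENNReal.ofReal p.1 * (g p.1 * h p.2) =
      (∫⁻ s in Set.Ioi (0 : ℝ), ENNReal.ofReal s * g s) * ∫⁻ θ in Set.Ioo (-π) π, h θ := by
  have : polarCoord.target = Set.Ioi (0 : ℝ) ×ˢ Set.Ioo (-π) π := rfl
  rw [this, Measure.volume_eq_prod, ← Measure.prod_restrict,
    ← lintegral_prod_mul (by fun_prop) (by fun_prop)]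
  simp only [mul_assoc]

theorem Complex.lintegral_comp_norm {g : ℝ → ℝ≥0∞} (hg : Measurable g) :
    ∫⁻ z : ℂ, g ‖z‖ =
      (∫⁻ s in Set.Ioi (0 : ℝ), ENNReal.ofReal s * g s) * ENNReal.ofReal (2 * π) := by
  have h := lintegral_polarCoord_target_mul hg (h := fun _ => 1) measurable_const
  have hv : ∫⁻ _ in Set.Ioo (-π) π, (1 : ℝ≥0∞) = ENNReal.ofReal (2 * π) := by
    rw [setLIntegral_one, Real.volume_Ioo]; congr 1; ring
  rw [hv] at h
  rw [← h, ← Complex.lintegral_comp_polarCoord_symm]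
  refine setLIntegral_congr_fun polarCoord.open_target.measurableSet fun p hp => ?_
  have hp1 : 0 < p.1 := hp.1
  simp only [Complex.norm_polarCoord_symm, abs_of_pos hp1, smul_eq_mul, mul_one]

theorem Complex.lintegral_ball_inv_norm_le {ε : ℝ} :
    ∫⁻ z : ℂ, {z : ℂ | ‖z‖ < ε}.indicator (fun z => ENNReal.ofReal ‖z‖⁻¹) z ≤
      ENNReal.ofReal (2 * π * ε) := by
  have hm : Measurable ((Set.Iio ε).indicator fun s : ℝ => ENNReal.ofReal s⁻¹) :=
    Measurable.indicator (by fun_prop) measurableSet_Iio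
  have h : ∀ z : ℂ, {z : ℂ | ‖z‖ < ε}.indicator (fun z => ENNReal.ofReal ‖z‖⁻¹) z =
      (Set.Iio ε).indicator (fun s : ℝ => ENNReal.ofReal s⁻¹) ‖z‖ := by
    intro z
    simp only [Set.indicator_apply, Set.mem_ofPred_eq, Set.mem_Iio]
  simp_rw [h]
  rw [Complex.lintegral_comp_norm hm, mul_comm, ENNReal.ofReal_mul (p := 2 * π) (by positivity)]
  gcongr
  refine le_of_eq ?_
  calc ∫⁻ s in Set.Ioi (0 : ℝ), ENNReal.ofReal s *
        (Set.Iio ε).indicator (fun s : ℝ => ENNReal.ofReal s⁻¹) s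
      = ∫⁻ s in Set.Ioi (0 : ℝ), (Set.Iio ε).indicator (fun _ => 1) s := by
        refine setLIntegral_congr_fun measurableSet_Ioi fun s (hs : 0 < s) => ?_
        simp only [Set.indicator_apply]
        split_ifs
        · rw [← ENNReal.ofReal_mul hs.le, mul_inv_cancel₀ hs.ne', ENNReal.ofReal_one]
        · simp
    _ = ENNReal.ofReal ε := by
        rw [lintegral_indicator measurableSet_Iio, setLIntegral_one,
          Measure.restrict_apply measurableSet_Iio, Set.Iio_inter_Ioi, Real.volume_Ioo, sub_zero]

theorem lintegral_angular_kernel_le {ε r : ℝ} (hε : 0 < ε) (hr : 0 < r) :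
    ∫⁻ θ in Set.Ioo (-π) π, ENNReal.ofReal (2 / (ε + r / π * |θ|)) ≤
      ENNReal.ofReal (4 * π / r * Real.log (1 + r / ε)) := by
  have hc : 0 < r / π := by positivity
  have hpos : ∀ θ : ℝ, 0 < ε + r / π * |θ| := fun θ => by positivity
  have hcont : Continuous fun θ : ℝ => 2 / (ε + r / π * |θ|) := by
    refine Continuous.div (by fun_prop) (by fun_prop) fun θ => (hpos θ).ne'
  have hright : ∫ θ in (0 : ℝ)..π, 2 / (ε + r / π * |θ|) = 2 * π / r * Real.log (1 + r / ε) := by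
    calc ∫ θ in (0 : ℝ)..π, 2 / (ε + r / π * |θ|)
        = ∫ θ in (0 : ℝ)..π, 2 * (r / π * θ + ε)⁻¹ := by
          refine intervalIntegral.integral_congr fun θ hθ => ?_
          rw [Set.uIcc_of_le pi_pos.le] at hθ
          simp only [abs_of_nonneg hθ.1, div_eq_mul_inv, add_comm]
      _ = 2 * π / r * Real.log (1 + r / ε) := by
          rw [intervalIntegral.integral_const_mul,
            intervalIntegral.integral_comp_mul_add (fun x => x⁻¹) hc.ne',
            integral_inv_of_pos (by simpa using hε) (by positivity)]
          have : (r / π * π + ε) / (r / π * 0 + ε) = 1 + r / ε := by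
            field_simp; ring
          rw [this, smul_eq_mul]
          field_simp
  have hleft : ∫ θ in (-π)..0, 2 / (ε + r / π * |θ|) = 2 * π / r * Real.log (1 + r / ε) := by
    rw [← hright]
    simpa using (intervalIntegral.integral_comp_neg (a := 0) (b := π)
      fun θ : ℝ => 2 / (ε + r / π * |θ|)).symm
  rw [← ofReal_integral_eq_lintegral_ofReal]
  · rw [← integral_Ioc_eq_integral_Ioo, ← intervalIntegral.integral_of_le (by linarith [pi_pos]),
      ← intervalIntegral.integral_add_adjacent_intervals (b := 0)
        (hcont.intervalIntegrable _ _) (hcont.intervalIntegrable _ _), hleft, hright]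
    refine ENNReal.ofReal_le_ofReal (le_of_eq ?_)
    ring
  · exact (hcont.integrableOn_Icc (a := -π) (b := π)).mono_set Set.Ioo_subset_Icc_self
  · exact Filter.Eventually.of_forall fun θ => (div_pos two_pos (hpos θ)).le

theorem Complex.mul_abs_angle_le_norm_sub {r s θ : ℝ} (hr : 0 < r) (hs : r / 2 ≤ s)
    (hθ : |θ| ≤ π) : r / π * |θ| ≤ ‖(r : ℂ) - Complex.polarCoord.symm (s, θ)‖ := by
  have hcos := Real.cos_le_one_sub_mul_cos_sq hθ
  have hnorm : ‖(r : ℂ) - Complex.polarCoord.symm (s, θ)‖ ^ 2 =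
      (r - s) ^ 2 + 2 * r * s * (1 - Real.cos θ) := by
    rw [← Complex.normSq_eq_norm_sq, Complex.normSq_apply]
    simp only [Complex.polarCoord_symm_apply, Complex.sub_re, Complex.sub_im, Complex.mul_re,
      Complex.mul_im, Complex.add_re, Complex.add_im, Complex.ofReal_re, Complex.ofReal_im,
      Complex.I_re, Complex.I_im]
    linear_combination s ^ 2 * Real.sin_sq_add_cos_sq θ
  refine le_of_sq_le_sq ?_ (norm_nonneg _)
  rw [hnorm, mul_pow, div_pow, sq_abs]
  have h1 : 2 / π ^ 2 * θ ^ 2 ≤ 1 - Real.cos θ := by linarith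
  have h2 : r ^ 2 / π ^ 2 * θ ^ 2 ≤ r ^ 2 * (2 / π ^ 2 * θ ^ 2) := by
    have : 0 ≤ r ^ 2 / π ^ 2 * θ ^ 2 := by positivity
    calc _ ≤ 2 * (r ^ 2 / π ^ 2 * θ ^ 2) := by linarith
      _ = _ := by ring
  have h3 : r ^ 2 * (2 / π ^ 2 * θ ^ 2) ≤ 2 * r * s * (1 - Real.cos θ) :=
    mul_le_mul (by nlinarith) h1 (by positivity) (by nlinarith)
  nlinarith [sq_nonneg (r - s)]

theorem Complex.lintegral_radial_mul_inv_norm_sub_le {ε r : ℝ} (hε : 0 < ε) (hr : 1 + ε⁻¹ ≤ r)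
    {g : ℝ → ℝ≥0∞} (hg : Measurable g) (hg0 : ∀ s < r / 2, g s = 0) :
    ∫⁻ z : ℂ, {z : ℂ | ε ≤ ‖(r : ℂ) - z‖}.indicator
        (fun z => g ‖z‖ * ENNReal.ofReal ‖(r : ℂ) - z‖⁻¹) z ≤
      ENNReal.ofReal (4 * (Real.log r / r)) * ∫⁻ z : ℂ, g ‖z‖ := by
  have hε' : 0 < ε⁻¹ := inv_pos.2 hε
  have hr1 : 1 < r := by linarith
  have hr0 : 0 < r := by linarith
  have hlog : Real.log (1 + r / ε) ≤ 2 * Real.log r := by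
    have : Real.log (r ^ 2) = 2 * Real.log r := by simp
    rw [← this]
    refine Real.log_le_log (by positivity) ?_
    rw [div_eq_mul_inv]
    nlinarith
  have hh : Measurable fun θ : ℝ => ENNReal.ofReal (2 / (ε + r / π * |θ|)) := by fun_prop
  calc _ = ∫⁻ p in polarCoord.target, ENNReal.ofReal p.1 •
          {z : ℂ | ε ≤ ‖(r : ℂ) - z‖}.indicator
            (fun z => g ‖z‖ * ENNReal.ofReal ‖(r : ℂ) - z‖⁻¹) (Complex.polarCoord.symm p) :=
        (Complex.lintegral_comp_polarCoord_symm _).symm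
    _ ≤ ∫⁻ p in polarCoord.target, ENNReal.ofReal p.1 *
          (g p.1 * ENNReal.ofReal (2 / (ε + r / π * |p.2|))) := by
        refine setLIntegral_mono' polarCoord.open_target.measurableSet ?_
        rintro ⟨s, θ⟩ ⟨hs : 0 < s, hθ : -π < θ ∧ θ < π⟩
        rw [smul_eq_mul]
        gcongr
        rw [Set.indicator_apply]
        split_ifs with hz
        swap
        · exact zero_le
        rw [Complex.norm_polarCoord_symm, abs_of_pos hs]
        rcases lt_or_ge s (r / 2) with hsr | hsr
        · simp [hg0 s hsr]
        gcongr
        have h1 := Complex.mul_abs_angle_le_norm_sub hr0 hsr (abs_le.2 ⟨hθ.1.le, hθ.2.le⟩)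
        have h2 : ε ≤ ‖(r : ℂ) - Complex.polarCoord.symm (s, θ)‖ := hz
        rw [inv_eq_one_div, div_le_div_iff₀ (hε.trans_le h2) (by positivity)]
        linarith
    _ = (∫⁻ s in Set.Ioi (0 : ℝ), ENNReal.ofReal s * g s) *
          ∫⁻ θ in Set.Ioo (-π) π, ENNReal.ofReal (2 / (ε + r / π * |θ|)) :=
        lintegral_polarCoord_target_mul hg hh
    _ ≤ (∫⁻ s in Set.Ioi (0 : ℝ), ENNReal.ofReal s * g s) *
          ENNReal.ofReal (4 * (Real.log r / r) * (2 * π)) := by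
        gcongr
        refine (lintegral_angular_kernel_le hε hr0).trans (ENNReal.ofReal_le_ofReal ?_)
        calc 4 * π / r * Real.log (1 + r / ε) ≤ 4 * π / r * (2 * Real.log r) := by gcongr
          _ = _ := by ring
    _ = _ := by
        rw [Complex.lintegral_comp_norm hg,
          ENNReal.ofReal_mul (by have := Real.log_nonneg hr1.le; positivity)]
        ring

theorem exists_linearIsometryEquiv_complex_apply_norm (x : EuclideanSpace ℝ (Fin 2)) :
    ∃ L : ℂ ≃ₗᵢ[ℝ] EuclideanSpace ℝ (Fin 2), L (‖x‖ : ℂ) = x := by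
  let L₀ := Complex.orthonormalBasisOneI.repr
  refine ⟨(rotation (Circle.exp (Complex.arg (L₀.symm x)))).trans L₀, ?_⟩
  rw [LinearIsometryEquiv.trans_apply, rotation_apply, ← L₀.symm.norm_map x, Circle.coe_exp,
    mul_comm, Complex.norm_mul_exp_arg_mul_I, L₀.apply_symm_apply]

theorem exists_setIntegral_norm_gt_lt {E : Type*} [NormedAddCommGroup E] [MeasurableSpace E]
    [OpensMeasurableSpace E] {μ : Measure E} {f : E → ℝ} (hf : Integrable f μ) {η : ℝ}
    (hη : 0 < η) : ∃ M : ℝ, 0 < M ∧ ∫ y in {y | M < ‖y‖}, f y ∂μ < η := by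
  have h := tendsto_setIntegral_of_antitone (μ := μ) (f := f)
    (s := fun n : ℕ => {y | (n : ℝ) < ‖y‖})
    (fun n => measurableSet_lt measurable_const measurable_norm)
    (fun m n hmn y (hy : (n : ℝ) < ‖y‖) => lt_of_le_of_lt (by exact_mod_cast hmn) hy)
    ⟨0, hf.integrableOn⟩
  have he : ⋂ n : ℕ, {y : E | (n : ℝ) < ‖y‖} = ∅ := by
    refine Set.eq_empty_of_forall_notMem fun y hy => ?_
    obtain ⟨n, hn⟩ := exists_nat_ge ‖y‖
    exact (Set.mem_iInter.1 hy n).not_ge hn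
  rw [he, setIntegral_empty] at h
  obtain ⟨n, hn, hn0⟩ := ((h.eventually_lt_const hη).and (Filter.eventually_gt_atTop 0)).exists
  exact ⟨n, by exact_mod_cast hn0, hn⟩

theorem lintegral_inv_norm_sub_ball_le (x : EuclideanSpace ℝ (Fin 2)) {ε : ℝ} :
    ∫⁻ y, {y | ‖x - y‖ < ε}.indicator (fun y => ENNReal.ofReal ‖x - y‖⁻¹) y ≤
      ENNReal.ofReal (2 * π * ε) := by
  let L := Complex.orthonormalBasisOneI.repr
  have hm : Measurable fun w : EuclideanSpace ℝ (Fin 2) =>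
      {w | ‖w‖ < ε}.indicator (fun w => ENNReal.ofReal ‖w‖⁻¹) w :=
    Measurable.indicator (by fun_prop) (measurableSet_lt measurable_norm measurable_const)
  refine (lintegral_sub_left_eq_self (fun w : EuclideanSpace ℝ (Fin 2) =>
    {w | ‖w‖ < ε}.indicator (fun w => ENNReal.ofReal ‖w‖⁻¹) w) x).trans_le ?_
  rw [← L.measurePreserving.lintegral_comp hm]
  refine le_of_eq_of_le (lintegral_congr fun z => ?_) (Complex.lintegral_ball_inv_norm_le (ε := ε))
  simp only [Set.indicator_apply, Set.mem_ofPred_eq, L.norm_map]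

theorem lintegral_radial_mul_inv_norm_sub_le (x : EuclideanSpace ℝ (Fin 2)) {ε : ℝ} (hε : 0 < ε)
    (hx : 1 + ε⁻¹ ≤ ‖x‖) {f : EuclideanSpace ℝ (Fin 2) → ℝ≥0∞} (hf : Measurable f)
    (hrad : ∀ y z, ‖y‖ = ‖z‖ → f y = f z) (hf0 : ∀ y, ‖y‖ < ‖x‖ / 2 → f y = 0) :
    ∫⁻ y, {y | ε ≤ ‖x - y‖}.indicator (fun y => f y * ENNReal.ofReal ‖x - y‖⁻¹) y ≤
      ENNReal.ofReal (4 * (Real.log ‖x‖ / ‖x‖)) * ∫⁻ y, f y := by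
  obtain ⟨L, hL⟩ := exists_linearIsometryEquiv_complex_apply_norm x
  have hLm : Measurable fun s : ℝ => L (s : ℂ) :=
    L.continuous.measurable.comp Complex.measurable_ofReal
  let g : ℝ → ℝ≥0∞ := (Set.Ici 0).indicator fun s => f (L (s : ℂ))
  have hg : Measurable g := (hf.comp hLm).indicator measurableSet_Ici
  have hgf : ∀ z : ℂ, g ‖z‖ = f (L z) := fun z => by
    rw [show g ‖z‖ = f (L (‖z‖ : ℂ)) from Set.indicator_of_mem (Set.mem_Ici.2 (norm_nonneg z)) _]
    exact hrad _ _ (by simp)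
  have hg0 : ∀ s < ‖x‖ / 2, g s = 0 := fun s hs => by
    refine Set.indicator_apply_eq_zero.2 fun h0 => hf0 _ ?_
    rwa [L.norm_map, Complex.norm_real, norm_of_nonneg h0]
  have hm : Measurable
      ({y | ε ≤ ‖x - y‖}.indicator fun y => f y * ENNReal.ofReal ‖x - y‖⁻¹) :=
    Measurable.indicator (by fun_prop) (measurableSet_le measurable_const (by fun_prop))
  have hnorm : ∀ z : ℂ, ‖x - L z‖ = ‖(‖x‖ : ℂ) - z‖ := fun z => by
    rw [← L.norm_map, map_sub, hL]
  have key := Complex.lintegral_radial_mul_inv_norm_sub_le hε hx hg hg0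
  simp_rw [hgf] at key
  rw [L.measurePreserving.lintegral_comp hf] at key
  rw [← L.measurePreserving.lintegral_comp hm]
  refine le_of_eq_of_le (lintegral_congr fun z => ?_) key
  simp only [Set.indicator_apply, Set.mem_ofPred_eq, hnorm]

theorem coulomb_kernel_split_le {x y : EuclideanSpace ℝ (Fin 2)} {M ε a : ℝ} (hM : 0 < M)
    (hx : M < ‖x‖) (ha : 0 ≤ a) (hay : a ≤ (2 * π * ‖y‖)⁻¹) :
    ENNReal.ofReal (a / ‖x - y‖) ≤
      ENNReal.ofReal (a * (‖x‖ - M)⁻¹) +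
      {y : EuclideanSpace ℝ (Fin 2) | M < ‖y‖}.indicator
        (fun _ => ENNReal.ofReal (a * (2 / ‖x‖))) y +
      ENNReal.ofReal (π * ‖x‖)⁻¹ *
        {y | ‖x - y‖ < ε}.indicator (fun y => ENNReal.ofReal ‖x - y‖⁻¹) y +
      {y | ε ≤ ‖x - y‖}.indicator (fun y =>
        {y : EuclideanSpace ℝ (Fin 2) | ‖x‖ / 2 ≤ ‖y‖ ∧ ‖y‖ ≤ 3 * ‖x‖ / 2}.indicator
          (fun _ => ENNReal.ofReal a) y * ENNReal.ofReal ‖x - y‖⁻¹) y := by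
  have hx0 : 0 < ‖x‖ := hM.trans hx
  rcases le_or_gt ‖y‖ M with hyM | hyM
  · refine le_add_right (le_add_right (le_add_right (ENNReal.ofReal_le_ofReal ?_)))
    rw [div_eq_mul_inv]
    gcongr
    linarith [norm_sub_norm_le x y]
  by_cases hS : ‖x‖ / 2 ≤ ‖y‖ ∧ ‖y‖ ≤ 3 * ‖x‖ / 2
  · rcases lt_or_ge ‖x - y‖ ε with hε | hε
    · refine le_add_right (le_add_left ?_)
      rw [Set.indicator_of_mem (show y ∈ {y | ‖x - y‖ < ε} from hε),
        ← ENNReal.ofReal_mul (by positivity), div_eq_mul_inv]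
      gcongr
      refine hay.trans (inv_anti₀ (by positivity) ?_)
      nlinarith [pi_pos, hS.1]
    · refine le_add_left ?_
      rw [Set.indicator_of_mem (show y ∈ {y | ε ≤ ‖x - y‖} from hε),
        Set.indicator_of_mem (show y ∈ {y : EuclideanSpace ℝ (Fin 2) |
          ‖x‖ / 2 ≤ ‖y‖ ∧ ‖y‖ ≤ 3 * ‖x‖ / 2} from hS),
        ← ENNReal.ofReal_mul ha, div_eq_mul_inv]
  · refine le_add_right (le_add_right (le_add_left ?_))
    rw [Set.indicator_of_mem (show y ∈ {y : EuclideanSpace ℝ (Fin 2) | M < ‖y‖} from hyM),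
      div_eq_mul_inv]
    gcongr
    have h : ‖x‖ / 2 ≤ ‖x - y‖ := by
      rcases not_and_or.1 hS with h | h
      · linarith [norm_sub_norm_le x y]
      · linarith [norm_sub_norm_le y x, norm_sub_rev x y]
    rw [← inv_div]
    exact inv_anti₀ (by positivity) h

/-- **Coulomb potential decay bound.** There is a universal constant `C₁ > 0` such that:
for every measurable, radially symmetric `ρ : ℝ² → [0,∞)` with `ρ(x) ≤ (2π|x|)⁻¹` a.e.
and `∫ ρ = λ`, and every `δ > 0`, there is `R > 0` such that for all `|x| ≥ R`,
`∫ ρ(y)/|x − y| dy ≤ (λ + δ)/|x| + C₁ (ln|x|/|x|) ∫_{|x|/2 ≤ |y| ≤ 3|x|/2} ρ(y) dy`. -/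
theorem coulomb_potential_far_field_bound :
    ∃ C₁ : ℝ, 0 < C₁ ∧
      ∀ (ρ : EuclideanSpace ℝ (Fin 2) → ℝ) (lam : ℝ),
        Measurable ρ →
        (∀ x, 0 ≤ ρ x) →
        (∀ x y : EuclideanSpace ℝ (Fin 2), ‖x‖ = ‖y‖ → ρ x = ρ y) →
        Integrable ρ →
        (∫ x : EuclideanSpace ℝ (Fin 2), ρ x) = lam →
        (∀ᵐ x : EuclideanSpace ℝ (Fin 2), ρ x ≤ (2 * Real.pi * ‖x‖)⁻¹) →
        ∀ δ : ℝ, 0 < δ → ∃ R : ℝ, 0 < R ∧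
          ∀ x : EuclideanSpace ℝ (Fin 2), R ≤ ‖x‖ →
            (∫⁻ y : EuclideanSpace ℝ (Fin 2), ENNReal.ofReal (ρ y / ‖x - y‖))
              ≤ ENNReal.ofReal ((lam + δ) / ‖x‖ +
                  C₁ * (Real.log ‖x‖ / ‖x‖) *
                    ∫ y in {y : EuclideanSpace ℝ (Fin 2) |
                        ‖x‖ / 2 ≤ ‖y‖ ∧ ‖y‖ ≤ 3 * ‖x‖ / 2}, ρ y) := by
  refine ⟨4, by norm_num, fun ρ lam hρm hρ0 hrad hρi hlam hbound δ hδ => ?_⟩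
  obtain ⟨M, hM, hMδ⟩ := exists_setIntegral_norm_gt_lt hρi (show 0 < δ / 8 by positivity)
  have hlam0 : 0 ≤ lam := hlam ▸ integral_nonneg hρ0
  set ε : ℝ := δ / 8 with hεdef
  have hε : 0 < ε := by positivity
  have hR : 0 < 1 + ε⁻¹ + M * (4 * lam / δ + 1) := by positivity
  refine ⟨_, hR, fun x hx => ?_⟩
  have hMlam : 0 ≤ M * (4 * lam / δ) := by positivity
  have hε' : 0 < ε⁻¹ := by positivity
  have hxM : M < ‖x‖ := by linarith
  have hx1 : 1 + ε⁻¹ ≤ ‖x‖ := by linarith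
  have hx0 : 0 < ‖x‖ := by linarith
  have hlog := Real.log_nonneg (show 1 ≤ ‖x‖ by linarith)
  set S := {y : EuclideanSpace ℝ (Fin 2) | ‖x‖ / 2 ≤ ‖y‖ ∧ ‖y‖ ≤ 3 * ‖x‖ / 2} with hSdef
  have hS : MeasurableSet S := (measurableSet_le measurable_const measurable_norm).inter
    (measurableSet_le measurable_norm measurable_const)
  have hT : MeasurableSet {y : EuclideanSpace ℝ (Fin 2) | M < ‖y‖} :=
    measurableSet_lt measurable_const measurable_norm
  have hB : MeasurableSet {y | ‖x - y‖ < ε} := measurableSet_lt (by fun_prop) measurable_const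
  have hinner : ∫⁻ y, ENNReal.ofReal (ρ y * (‖x‖ - M)⁻¹) ≤
      ENNReal.ofReal ((lam + δ / 4) / ‖x‖) := by
    rw [← ofReal_integral_eq_lintegral_ofReal (hρi.mul_const _) (.of_forall fun y =>
      mul_nonneg (hρ0 y) (inv_nonneg.2 (by linarith))), integral_mul_const, hlam]
    refine ENNReal.ofReal_le_ofReal ?_
    rw [← div_eq_mul_inv, div_le_div_iff₀ (by linarith) hx0]
    have h : M * (4 * lam / δ + 1) * (δ / 4) ≤ ‖x‖ * (δ / 4) := by
      gcongr
      linarith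
    have h' : M * (4 * lam / δ + 1) * (δ / 4) = M * (lam + δ / 4) := by
      field_simp
    linarith
  have houter : ∫⁻ y, {y : EuclideanSpace ℝ (Fin 2) | M < ‖y‖}.indicator
      (fun y => ENNReal.ofReal (ρ y * (2 / ‖x‖))) y ≤ ENNReal.ofReal (δ / 4 / ‖x‖) := by
    rw [lintegral_indicator hT, ← ofReal_integral_eq_lintegral_ofReal
      (hρi.mul_const _).integrableOn (.of_forall fun y =>
      mul_nonneg (hρ0 y) (by positivity)), integral_mul_const]
    refine ENNReal.ofReal_le_ofReal ?_
    calc _ ≤ δ / 8 * (2 / ‖x‖) := by gcongr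
      _ = _ := by ring
  have hnear : ∫⁻ y, ENNReal.ofReal (π * ‖x‖)⁻¹ *
      {y | ‖x - y‖ < ε}.indicator (fun y => ENNReal.ofReal ‖x - y‖⁻¹) y ≤
        ENNReal.ofReal (δ / 4 / ‖x‖) := by
    rw [lintegral_const_mul _ (Measurable.indicator (by fun_prop) hB)]
    calc _ ≤ ENNReal.ofReal (π * ‖x‖)⁻¹ * ENNReal.ofReal (2 * π * ε) := by
          gcongr
          exact lintegral_inv_norm_sub_ball_le x
      _ = _ := by
          rw [← ENNReal.ofReal_mul (by positivity)]
          congr 1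
          rw [hεdef]
          field_simp
          norm_num
  have hfm : Measurable (S.indicator fun y => ENNReal.ofReal (ρ y)) :=
    hρm.ennreal_ofReal.indicator hS
  have hshell : ∫⁻ y, {y | ε ≤ ‖x - y‖}.indicator (fun y =>
      S.indicator (fun y => ENNReal.ofReal (ρ y)) y * ENNReal.ofReal ‖x - y‖⁻¹) y ≤
        ENNReal.ofReal (4 * (Real.log ‖x‖ / ‖x‖) * ∫ y in S, ρ y) := by
    refine (lintegral_radial_mul_inv_norm_sub_le x hε hx1 hfm (fun y z h => ?_)
      fun y h => Set.indicator_of_notMem (fun hy => h.not_ge hy.1) _).trans_eq ?_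
    · simp only [Set.indicator_apply, hSdef, Set.mem_ofPred_eq, h, hrad y z h]
    · rw [lintegral_indicator hS, ← ofReal_integral_eq_lintegral_ofReal hρi.integrableOn
        (.of_forall hρ0), ← ENNReal.ofReal_mul (by positivity)]
  have hI : 0 ≤ ∫ y in S, ρ y := integral_nonneg hρ0
  calc ∫⁻ y, ENNReal.ofReal (ρ y / ‖x - y‖)
      ≤ ∫⁻ y, (ENNReal.ofReal (ρ y * (‖x‖ - M)⁻¹) +
          {y : EuclideanSpace ℝ (Fin 2) | M < ‖y‖}.indicator
            (fun y => ENNReal.ofReal (ρ y * (2 / ‖x‖))) y +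
          ENNReal.ofReal (π * ‖x‖)⁻¹ *
            {y | ‖x - y‖ < ε}.indicator (fun y => ENNReal.ofReal ‖x - y‖⁻¹) y +
          {y | ε ≤ ‖x - y‖}.indicator (fun y =>
            S.indicator (fun y => ENNReal.ofReal (ρ y)) y * ENNReal.ofReal ‖x - y‖⁻¹) y) := by
        refine lintegral_mono_ae ?_
        filter_upwards [hbound] with y hy
        exact coulomb_kernel_split_le hM hxM (hρ0 y) hy
    _ ≤ ENNReal.ofReal ((lam + δ / 4) / ‖x‖) + ENNReal.ofReal (δ / 4 / ‖x‖) +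
          ENNReal.ofReal (δ / 4 / ‖x‖) +
          ENNReal.ofReal (4 * (Real.log ‖x‖ / ‖x‖) * ∫ y in S, ρ y) := by
        have hm₁ : Measurable fun y => ENNReal.ofReal (ρ y * (‖x‖ - M)⁻¹) := by fun_prop
        have hm₂ : Measurable ({y : EuclideanSpace ℝ (Fin 2) | M < ‖y‖}.indicator
            fun y => ENNReal.ofReal (ρ y * (2 / ‖x‖))) := Measurable.indicator (by fun_prop) hT
        have hm₃ : Measurable fun y => ENNReal.ofReal (π * ‖x‖)⁻¹ *
            {y | ‖x - y‖ < ε}.indicator (fun y => ENNReal.ofReal ‖x - y‖⁻¹) y :=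
          (Measurable.indicator (by fun_prop) hB).const_mul _
        rw [lintegral_add_left ((hm₁.fun_add hm₂).fun_add hm₃),
          lintegral_add_left (hm₁.fun_add hm₂),
          lintegral_add_left hm₁]
        gcongr
    _ ≤ _ := by
        rw [← ENNReal.ofReal_add (by positivity) (by positivity),
          ← ENNReal.ofReal_add (by positivity) (by positivity),
          ← ENNReal.ofReal_add (by positivity) (by positivity)]
        refine ENNReal.ofReal_le_ofReal (add_le_add_left ?_ _)
        rw [← add_div, ← add_div]
        exact div_le_div_of_nonneg_right (by linarith) hx0.le
end

section
/- For every x ∈ ℝ² and every real number 0 ≤ t < |x|, the average of the Coulomb kernel over the circle of radius t satisfies (2π)^{-1} ∫_0^{2π} |x − t(cos θ, sin θ)|^{-1} dθ ≥ 1/|x|. -/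
open Real MeasureTheory

/-- Passing to norms in the mean value property of the holomorphic function `z ↦ (w - z)⁻¹`. -/
lemma inv_norm_le_circleAverage_inv_norm_sub {w : ℂ} {t : ℝ} (ht0 : 0 ≤ t) (ht : t < ‖w‖) :
    ‖w‖⁻¹ ≤ circleAverage (fun z : ℂ ↦ ‖w - z‖⁻¹) 0 t := by
  have hdiff : DifferentiableOn ℂ (fun z : ℂ ↦ (w - z)⁻¹) (Metric.closedBall 0 |t|) := by
    refine ((differentiableOn_const w).fun_sub differentiableOn_id).fun_inv fun z hz ↦ ?_
    rw [sub_ne_zero]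
    rintro rfl
    rw [mem_closedBall_zero_iff, abs_of_nonneg ht0] at hz
    exact hz.not_gt ht
  have hmean : circleAverage (fun z : ℂ ↦ (w - z)⁻¹) 0 t = w⁻¹ := by
    simpa using (hdiff.diffContOnCl_ball subset_rfl).circleAverage
  calc ‖w‖⁻¹ = ‖circleAverage (fun z : ℂ ↦ (w - z)⁻¹) 0 t‖ := by rw [hmean, norm_inv]
    _ ≤ circleAverage (fun z : ℂ ↦ ‖w - z‖⁻¹) 0 t := by
      simp only [circleAverage_def, norm_smul, smul_eq_mul, ← norm_inv]
      rw [Real.norm_of_nonneg (by positivity : (0 : ℝ) ≤ (2 * π)⁻¹)]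
      gcongr
      exact intervalIntegral.norm_integral_le_integral_norm two_pi_pos.le

/-- For every `x ∈ ℝ²` and every real `0 ≤ t < ‖x‖`, the average of the Coulomb kernel
over the circle of radius `t` satisfies
`(2π)⁻¹ ∫_0^{2π} ‖x − t(cos θ, sin θ)‖⁻¹ dθ ≥ ‖x‖⁻¹`. -/
theorem circle_average_coulomb_kernel_ge
    (x : EuclideanSpace ℝ (Fin 2)) (t : ℝ) (ht0 : 0 ≤ t) (ht : t < ‖x‖) :
    (2 * Real.pi)⁻¹ *
        ∫ θ in (0:ℝ)..(2 * Real.pi),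
          ‖x - (EuclideanSpace.equiv (Fin 2) ℝ).symm ![t * Real.cos θ, t * Real.sin θ]‖⁻¹
      ≥ ‖x‖⁻¹ := by
  have hx : ‖(⟨x 0, x 1⟩ : ℂ)‖ = ‖x‖ := by
    simp [Complex.norm_eq_sqrt_sq_add_sq, EuclideanSpace.norm_eq]
  have hsub (θ : ℝ) : ‖(⟨x 0, x 1⟩ : ℂ) - circleMap 0 t θ‖ =
      ‖x - (EuclideanSpace.equiv (Fin 2) ℝ).symm ![t * Real.cos θ, t * Real.sin θ]‖ := by
    simp [Complex.norm_eq_sqrt_sq_add_sq, EuclideanSpace.norm_eq, circleMap,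
      Complex.exp_ofReal_mul_I_re, Complex.exp_ofReal_mul_I_im]
  have h := inv_norm_le_circleAverage_inv_norm_sub ht0 (hx ▸ ht)
  simpa only [circleAverage_def, smul_eq_mul, hsub, hx] using h
end

section
/- Let μ > 0 and let ρ : ℝ² → [0, ∞) be measurable, radially symmetric, integrable, and satisfy the Thomas–Fermi equation 2πρ(x) = [ |x|^{-1} − (ρ ∗ |·|^{-1})(x) − μ ]_+ for a.e. x ≠ 0. Then ∫_{ℝ²} ρ < 1, and ρ has compact support: ρ(x) = 0 for a.e. x with |x| ≥ μ^{-1}(1 − ∫ρ). -/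
open Real MeasureTheory

/-- By the mean value property of `y ↦ (x - y)⁻¹`, the circle average of `‖x - y‖⁻¹` over a
centred circle not enclosing `x` is at least `‖x‖⁻¹`. -/
theorem inv_norm_le_circleAverage {x : ℂ} {s : ℝ} (hs : 0 ≤ s) (hsx : s < ‖x‖) :
    ‖x‖⁻¹ ≤ circleAverage (fun y => ‖x - y‖⁻¹) 0 s := by
  have hne : ∀ y ∈ Metric.closedBall (0 : ℂ) |s|, x - y ≠ 0 := by
    intro y hy h
    rw [sub_eq_zero] at h
    rw [mem_closedBall_zero_iff, abs_of_nonneg hs, ← h] at hy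
    linarith
  have hd : DifferentiableOn ℂ (fun y : ℂ => (x - y)⁻¹) (Metric.closedBall 0 |s|) := by
    intro y hy
    exact ((differentiableAt_const x).sub differentiableAt_id).inv (hne y hy)
      |>.differentiableWithinAt
  have hmean : circleAverage (fun y : ℂ => (x - y)⁻¹) 0 s = x⁻¹ := by
    simpa using circleAverage_of_differentiable_on_off_countable (f := fun y : ℂ => (x - y)⁻¹)
      (c := 0) (R := s) Set.countable_empty hd.continuousOn
      (fun y hy => ((differentiableAt_const x).sub differentiableAt_id).inv
        (hne y (Metric.ball_subset_closedBall hy.1)))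
  rw [← norm_inv, ← hmean, circleAverage, circleAverage, norm_smul, smul_eq_mul,
    Real.norm_of_nonneg (by positivity)]
  gcongr
  refine (intervalIntegral.norm_integral_le_integral_norm two_pi_pos.le).trans_eq ?_
  simp [norm_inv]

theorem ofReal_two_pi_mul_inv_norm_le_lintegral {x : ℂ} {s : ℝ} (hs : 0 ≤ s) (hsx : s < ‖x‖) :
    ENNReal.ofReal ‖x‖⁻¹ * ENNReal.ofReal (2 * π) ≤
      ∫⁻ θ in Set.Ioo (-π) π, ENNReal.ofReal ‖x - Complex.polarCoord.symm (s, θ)‖⁻¹ := by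
  have hcont : Continuous fun θ : ℝ => ‖x - Complex.polarCoord.symm (s, θ)‖⁻¹ := by
    simp only [Complex.polarCoord_symm_apply]
    refine Continuous.inv₀ (by fun_prop) fun θ h => ?_
    rw [norm_eq_zero, sub_eq_zero] at h
    rw [h, ← Complex.polarCoord_symm_apply (s, θ), Complex.norm_polarCoord_symm,
      abs_of_nonneg hs] at hsx
    exact lt_irrefl _ hsx
  have havg := inv_norm_le_circleAverage hs hsx
  rw [circleAverage_eq_integral_add (-π),
    intervalIntegral.integral_comp_add_right (fun θ => ‖x - circleMap 0 s θ‖⁻¹), smul_eq_mul,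
    inv_mul_eq_div, le_div_iff₀ two_pi_pos] at havg
  have hint : IntegrableOn (fun θ : ℝ => ‖x - Complex.polarCoord.symm (s, θ)‖⁻¹)
      (Set.Ioo (-π) π) :=
    (hcont.integrableOn_Icc).mono_set Set.Ioo_subset_Icc_self
  rw [← ENNReal.ofReal_mul (by positivity),
    ← ofReal_integral_eq_lintegral_ofReal hint (ae_of_all _ fun θ => by positivity),
    ← integral_Ioc_eq_integral_Ioo, ← intervalIntegral.integral_of_le (by linarith [pi_pos])]
  refine ENNReal.ofReal_le_ofReal (havg.trans_eq ?_)
  rw [show (0 : ℝ) + -π = -π by ring, show 2 * π + -π = π by ring]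
  congr 1 with θ
  simp [circleMap, Complex.exp_mul_I]

/-- The potential at `x` of a radial charge density in the plane is at least that of the charge
inside `ball 0 ‖x‖` concentrated at the origin. -/
theorem lintegral_ball_mul_inv_norm_le {ρ : ℂ → ENNReal} (hρ : Measurable ρ)
    (hrad : ∀ x y : ℂ, ‖x‖ = ‖y‖ → ρ x = ρ y) (x : ℂ) :
    (∫⁻ y in Metric.ball 0 ‖x‖, ρ y) * ENNReal.ofReal ‖x‖⁻¹ ≤
      ∫⁻ y, ρ y * ENNReal.ofReal ‖x - y‖⁻¹ := by
  have hm : Measurable fun y : ℂ => ρ y * ENNReal.ofReal ‖x - y‖⁻¹ := by fun_prop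
  have hi : Measurable ((Metric.ball (0 : ℂ) ‖x‖).indicator ρ) :=
    hρ.indicator measurableSet_ball
  have hp : Measurable fun p : ℝ × ℝ => Complex.polarCoord.symm p := by
    simp only [Complex.polarCoord_symm_apply]
    fun_prop
  rw [← lintegral_mul_const _ hρ, ← lintegral_indicator measurableSet_ball,
    ← Complex.lintegral_comp_polarCoord_symm, ← Complex.lintegral_comp_polarCoord_symm,
    polarCoord_target, Measure.volume_eq_prod]
  simp only [Set.indicator_mul_const, smul_eq_mul]
  rw [setLIntegral_prod, setLIntegral_prod]
  · refine setLIntegral_mono' measurableSet_Ioi fun r (hr : 0 < r) => ?_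
    have hconst : ∀ θ, ρ (Complex.polarCoord.symm (r, θ)) = ρ r := fun θ =>
      hrad _ _ (by simp [-Complex.polarCoord_symm_apply, Complex.norm_polarCoord_symm])
    by_cases hrx : r < ‖x‖
    · have hmem : ∀ θ, Complex.polarCoord.symm (r, θ) ∈ Metric.ball (0 : ℂ) ‖x‖ := fun θ => by
        rwa [mem_ball_zero_iff, Complex.norm_polarCoord_symm, abs_of_pos hr]
      simp only [Set.indicator_of_mem (hmem _), hconst, ← mul_assoc]
      rw [lintegral_const, lintegral_const_mul, mul_assoc, Measure.restrict_apply_univ,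
        Real.volume_Ioo, sub_neg_eq_add, ← two_mul]
      · gcongr
        exact ofReal_two_pi_mul_inv_norm_le_lintegral hr.le hrx
      · exact (measurable_const.sub (hp.comp measurable_prodMk_left)).norm.inv.ennreal_ofReal
    · have hmem : ∀ θ, Complex.polarCoord.symm (r, θ) ∉ Metric.ball (0 : ℂ) ‖x‖ := fun θ => by
        rwa [mem_ball_zero_iff, Complex.norm_polarCoord_symm, abs_of_pos hr]
      simp [Set.indicator_of_notMem (hmem _), -Complex.polarCoord_symm_apply]
  · exact ((measurable_fst.ennreal_ofReal).mul (hm.comp hp)).aemeasurable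
  · exact ((measurable_fst.ennreal_ofReal).mul ((hi.comp hp).mul_const _)).aemeasurable

theorem setIntegral_ball_div_norm_le_integral_div {ρ : EuclideanSpace ℝ (Fin 2) → ℝ} (hmeas : Measurable ρ)
    (hnonneg : ∀ x, 0 ≤ ρ x)
    (hrad : ∀ x y : EuclideanSpace ℝ (Fin 2), ‖x‖ = ‖y‖ → ρ x = ρ y) {x : EuclideanSpace ℝ (Fin 2)}
    (hint : Integrable fun y => ρ y / ‖x - y‖) :
    (∫ y in Metric.ball 0 ‖x‖, ρ y) / ‖x‖ ≤ ∫ y, ρ y / ‖x - y‖ := by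
  let e : ℂ ≃ₗᵢ[ℝ] EuclideanSpace ℝ (Fin 2) := Complex.orthonormalBasisOneI.repr
  have he : MeasurePreserving e := e.measurePreserving
  have hemb : MeasurableEmbedding e := e.toHomeomorph.measurableEmbedding
  have key := lintegral_ball_mul_inv_norm_le (ρ := fun z => ENNReal.ofReal (ρ (e z)))
    (hmeas.comp he.measurable).ennreal_ofReal
    (fun z w h => by rw [hrad (e z) (e w) (by simpa using h)]) (e.symm x)
  have h1 : ∫⁻ z, ENNReal.ofReal (ρ (e z)) * ENNReal.ofReal ‖e.symm x - z‖⁻¹ =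
      ∫⁻ y, ENNReal.ofReal (ρ y / ‖x - y‖) := by
    rw [← he.lintegral_comp_emb hemb]
    refine lintegral_congr fun z => ?_
    rw [← ENNReal.ofReal_mul (hnonneg _), ← e.norm_map (e.symm x - z), map_sub,
      e.apply_symm_apply, div_eq_mul_inv]
  have h2 : ∫⁻ z in Metric.ball 0 ‖e.symm x‖, ENNReal.ofReal (ρ (e z)) =
      ∫⁻ y in Metric.ball 0 ‖x‖, ENNReal.ofReal (ρ y) := by
    rw [← he.setLIntegral_comp_preimage_emb hemb]
    congr 2
    ext z
    simp
  rw [h1, h2, e.symm.norm_map] at key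
  rw [integral_eq_lintegral_of_nonneg_ae (ae_of_all _ hnonneg) hmeas.aestronglyMeasurable,
    integral_eq_lintegral_of_nonneg_ae
      (ae_of_all _ fun y => div_nonneg (hnonneg y) (norm_nonneg _)) hint.aestronglyMeasurable,
    div_eq_mul_inv, ← ENNReal.toReal_ofReal (inv_nonneg.2 (norm_nonneg x)), ← ENNReal.toReal_mul]
  exact ENNReal.toReal_mono hint.lintegral_lt_top.ne key

/-- The planar Coulomb potential of an integrable density converges almost everywhere. -/
theorem ae_integrable_div_norm_sub {ρ : EuclideanSpace ℝ (Fin 2) → ℝ} (hint : Integrable ρ) :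
    ∀ᵐ x, Integrable fun y => ρ y / ‖x - y‖ := by
  set g : EuclideanSpace ℝ (Fin 2) → ℝ := (Metric.ball 0 1).indicator fun x => ‖x‖⁻¹
  have hg : Integrable g := by
    rw [integrable_indicator_iff measurableSet_ball,
      integrableOn_fun_norm_addHaar (f := fun r : ℝ => r⁻¹) volume]
    refine (integrableOn_const (C := (1 : ℝ)) (by simp)).congr_fun (fun r hr => ?_) measurableSet_Ioo
    simp [mul_inv_cancel₀ hr.1.ne']
  filter_upwards [hint.ae_convolution_exists (ContinuousLinearMap.mul ℝ ℝ) hg] with x hx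
  have hfar : Integrable fun y => ρ y * (‖x - y‖⁻¹ - g (x - y)) := by
    refine hint.mul_bdd (c := 1) ?_ (ae_of_all _ fun y => ?_)
    · have hgm : Measurable g := (measurable_norm.inv).indicator measurableSet_ball
      fun_prop
    · by_cases h : x - y ∈ Metric.ball (0 : EuclideanSpace ℝ (Fin 2)) 1
      · simp [g, h]
      · rw [mem_ball_zero_iff, not_lt] at h
        simpa [g, h.not_gt] using inv_le_one_of_one_le₀ h
  refine (Integrable.add hx hfar).congr (ae_of_all _ fun y => ?_)
  simp only [ContinuousLinearMap.mul_apply', Pi.add_apply]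
  ring

/-- If the mass inside `ball 0 ‖x‖` is at most `1 - μ * ‖x‖` wherever `ρ x ≠ 0`, then letting `‖x‖`
tend to the outer radius of the support bounds the total mass and that radius. -/
theorem integral_lt_one_and_ae_eq_zero_of_ball_bound {μ : ℝ} (hμ : 0 < μ)
    {ρ : EuclideanSpace ℝ (Fin 2) → ℝ} (hnonneg : ∀ x, 0 ≤ ρ x) (hint : Integrable ρ)
    (hbound : ∀ᵐ x, ρ x ≠ 0 → x ≠ 0 ∧ ∫ y in Metric.ball 0 ‖x‖, ρ y ≤ 1 - μ * ‖x‖) :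
    (∫ x, ρ x) < 1 ∧ ∀ᵐ x, μ⁻¹ * (1 - ∫ y, ρ y) ≤ ‖x‖ → ρ x = 0 := by
  by_cases hzero : ρ =ᵐ[volume] 0
  · refine ⟨by simp [integral_congr_ae hzero], ?_⟩
    filter_upwards [hzero] with x hx _ using hx
  set A : Set ℝ :=
    {r | 0 < r ∧ ∫ y in Metric.ball (0 : EuclideanSpace ℝ (Fin 2)) r, ρ y ≤ 1 - μ * r}
  have hA : ∀ᵐ x, ρ x ≠ 0 → ‖x‖ ∈ A := by
    filter_upwards [hbound] with x hx h
    exact ⟨norm_pos_iff.2 (hx h).1, (hx h).2⟩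
  have hne : A.Nonempty := by
    by_contra h
    rw [Set.not_nonempty_iff_eq_empty] at h
    refine hzero ?_
    filter_upwards [hA] with x hx
    by_contra h0
    simpa [h] using hx h0
  have hbdd : BddAbove A := by
    refine ⟨μ⁻¹, fun r hr => ?_⟩
    have : 0 ≤ ∫ y in Metric.ball (0 : EuclideanSpace ℝ (Fin 2)) r, ρ y := integral_nonneg hnonneg
    rw [← one_div, le_div_iff₀ hμ]
    linarith [hr.2]
  set R := sSup A
  have hsphere : ∀ᵐ x : EuclideanSpace ℝ (Fin 2), ‖x‖ ≠ R := by
    have : volume (Metric.sphere (0 : EuclideanSpace ℝ (Fin 2)) R) = 0 := Measure.addHaar_sphere volume 0 R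
    rw [ae_iff]
    convert this using 2
    ext x
    simp
  have hsupp : ∀ᵐ x, R ≤ ‖x‖ → ρ x = 0 := by
    filter_upwards [hA, hsphere] with x hx hs hR
    by_contra h
    exact hs (le_antisymm (le_csSup hbdd (hx h)) hR)
  have hmass : ∫ y in Metric.ball (0 : EuclideanSpace ℝ (Fin 2)) R, ρ y = ∫ y, ρ y := by
    refine setIntegral_eq_integral_of_ae_compl_eq_zero ?_
    filter_upwards [hsupp] with x hx h
    exact hx (by simpa using h)
  have hlim : ∫ y, ρ y ≤ 1 - μ * R := by
    have hu : Filter.Tendsto (fun n : ℕ => R - 1 / ((n : ℝ) + 1)) Filter.atTop (nhds R) := by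
      simpa using tendsto_one_div_add_atTop_nhds_zero_nat.const_sub R
    have hmono : Monotone fun n : ℕ => Metric.ball (0 : EuclideanSpace ℝ (Fin 2)) (R - 1 / ((n : ℝ) + 1)) :=
      fun m n h => Metric.ball_subset_ball (sub_le_sub_left (Nat.one_div_le_one_div h) R)
    have hunion : ⋃ n : ℕ, Metric.ball (0 : EuclideanSpace ℝ (Fin 2)) (R - 1 / ((n : ℝ) + 1)) = Metric.ball 0 R := by
      ext x
      simp only [Set.mem_iUnion, mem_ball_zero_iff]
      refine ⟨fun ⟨n, hn⟩ => hn.trans (sub_lt_self R Nat.one_div_pos_of_nat), fun h => ?_⟩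
      exact (hu.eventually (lt_mem_nhds h)).exists
    have hQ := tendsto_setIntegral_of_monotone (fun n : ℕ => measurableSet_ball) hmono
      (hint.integrableOn (s := ⋃ n : ℕ, Metric.ball (0 : EuclideanSpace ℝ (Fin 2)) (R - 1 / ((n : ℝ) + 1))))
    rw [hunion, hmass] at hQ
    refine le_of_tendsto_of_tendsto' hQ ((hu.const_mul μ).const_sub 1) fun n => ?_
    obtain ⟨r, hr, hlt⟩ := exists_lt_of_lt_csSup hne
      (sub_lt_self R (Nat.one_div_pos_of_nat (n := n)))
    calc ∫ y in Metric.ball (0 : EuclideanSpace ℝ (Fin 2)) (R - 1 / ((n : ℝ) + 1)), ρ y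
        ≤ ∫ y in Metric.ball (0 : EuclideanSpace ℝ (Fin 2)) r, ρ y :=
          setIntegral_mono_set hint.integrableOn (ae_of_all _ hnonneg)
            (Metric.ball_subset_ball hlt.le).eventuallyLE
      _ ≤ 1 - μ * r := hr.2
      _ ≤ 1 - μ * (R - 1 / ((n : ℝ) + 1)) := by gcongr
  have hRpos : 0 < R := by
    obtain ⟨r, hr⟩ := hne
    exact hr.1.trans_le (le_csSup hbdd hr)
  refine ⟨by nlinarith [mul_pos hμ hRpos], ?_⟩
  filter_upwards [hsupp] with x hx h
  refine hx (le_trans ?_ h)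
  rw [← div_eq_inv_mul, le_div_iff₀ hμ]
  linarith

/-- **Thomas–Fermi equation with positive chemical potential.** If `μ > 0` and
`ρ : EuclideanSpace ℝ (Fin 2) → [0,∞)` is measurable, radially symmetric, integrable and satisfies
`2πρ(x) = [|x|⁻¹ − (ρ ∗ |·|⁻¹)(x) − μ]₊` a.e., then `∫ρ < 1` and `ρ` vanishes a.e.
on `{|x| ≥ μ⁻¹(1 − ∫ρ)}`. -/
theorem tf_equation_positive_mu
    (μ : ℝ) (hμ : 0 < μ)
    (ρ : EuclideanSpace ℝ (Fin 2) → ℝ)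
    (hmeas : Measurable ρ)
    (hnonneg : ∀ x, 0 ≤ ρ x)
    (hrad : ∀ x y : EuclideanSpace ℝ (Fin 2), ‖x‖ = ‖y‖ → ρ x = ρ y)
    (hint : Integrable ρ)
    (hTF : ∀ᵐ x : EuclideanSpace ℝ (Fin 2), x ≠ 0 →
      2 * Real.pi * ρ x
        = max (‖x‖⁻¹ - (∫ y : EuclideanSpace ℝ (Fin 2), ρ y / ‖x - y‖) - μ) 0) :
    (∫ x : EuclideanSpace ℝ (Fin 2), ρ x) < 1 ∧
      ∀ᵐ x : EuclideanSpace ℝ (Fin 2),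
        μ⁻¹ * (1 - ∫ y : EuclideanSpace ℝ (Fin 2), ρ y) ≤ ‖x‖ → ρ x = 0 := by
  refine integral_lt_one_and_ae_eq_zero_of_ball_bound hμ hnonneg hint ?_
  have hx0 : ∀ᵐ x : EuclideanSpace ℝ (Fin 2), x ≠ 0 := by simp [ae_iff]
  filter_upwards [hTF, hx0, ae_integrable_div_norm_sub hint] with x hx hx0 hxint hρ
  have hpos : 0 < max (‖x‖⁻¹ - (∫ y, ρ y / ‖x - y‖) - μ) 0 := by
    rw [← hx hx0]
    exact mul_pos two_pi_pos ((hnonneg x).lt_of_ne' hρ)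
  have hphi := (lt_max_iff.1 hpos).resolve_right (lt_irrefl 0)
  have hV := setIntegral_ball_div_norm_le_integral_div hmeas hnonneg hrad hxint
  have hnorm := norm_pos_iff.2 hx0
  refine ⟨hx0, ?_⟩
  have h : (∫ y in Metric.ball 0 ‖x‖, ρ y) / ‖x‖ ≤ ‖x‖⁻¹ - μ := by linarith
  rwa [div_le_iff₀ hnorm, sub_mul, inv_mul_cancel₀ hnorm.ne'] at h
end

section
/- Let ρ : ℝ² → [0, ∞) be measurable, radially symmetric, integrable, and satisfy the Thomas–Fermi equation with zero chemical potential, 2πρ(x) = [ |x|^{-1} − (ρ ∗ |·|^{-1})(x) ]_+ for a.e. x ≠ 0. Then ∫_{ℝ²} ρ = 1, and the tails of ρ obey the lower bound ∫_{|x| ≥ r} ρ(x) dx ≥ e^{−2√r} for every r ≥ 0. In particular the support of ρ is unbounded. -/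
open Real MeasureTheory

/-- Polar coordinates for a radial function on the plane. -/
lemma integral_fun_norm_complex (f : ℝ → ℝ) :
    ∫ x : ℂ, f ‖x‖ = 2 * π * ∫ s in Set.Ioi (0 : ℝ), s * f s := by
  rw [integral_fun_norm_addHaar]
  simp [Complex.finrank_real_complex, Measure.real, Complex.volume_ball]
  ring

lemma lintegral_ball_norm_inv {R : ℝ} (hR : 0 ≤ R) :
    ∫⁻ x in Metric.ball (0 : ℂ) R, ENNReal.ofReal ‖x‖⁻¹ = ENNReal.ofReal (2 * π * R) := by
  have hind : (fun x : ℂ => (Metric.ball (0 : ℂ) R).indicator (fun x => ‖x‖⁻¹) x)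
      = fun x : ℂ => (Set.Iio R).indicator (fun s : ℝ => s⁻¹) ‖x‖ := by
    ext x
    simp [Set.indicator]
  have hcongr : ∀ s ∈ Set.Ioi (0 : ℝ), s * (Set.Iio R).indicator (fun s : ℝ => s⁻¹) s
      = (Set.Iio R).indicator (fun _ => (1 : ℝ)) s := by
    intro s hs
    have : s ≠ 0 := ne_of_gt hs
    by_cases h : s < R <;> simp [Set.indicator, h, this]
  have hintble : IntegrableOn (fun x : ℂ => ‖x‖⁻¹) (Metric.ball 0 R) := by
    rw [← integrable_indicator_iff measurableSet_ball]
    change Integrable (fun x : ℂ => (Metric.ball (0 : ℂ) R).indicator (fun x => ‖x‖⁻¹) x)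
    rw [hind, integrable_fun_norm_addHaar volume]
    simp only [Complex.finrank_real_complex, Nat.add_one_sub_one, pow_one, smul_eq_mul]
    rw [integrableOn_congr_fun hcongr measurableSet_Ioi, IntegrableOn,
      integrable_indicator_iff measurableSet_Iio, IntegrableOn,
      Measure.restrict_restrict measurableSet_Iio, Set.inter_comm, Set.Ioi_inter_Iio]
    exact integrable_const _
  rw [← ofReal_integral_eq_lintegral_ofReal hintble (ae_of_all _ fun x => by positivity)]
  congr 1
  rw [← integral_indicator measurableSet_ball, hind, integral_fun_norm_complex,
    setIntegral_congr_fun measurableSet_Ioi hcongr, setIntegral_indicator measurableSet_Iio,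
    Set.Ioi_inter_Iio]
  simp [hR]

/-- Among all discs of radius `R`, the one centred at the pole maximises the integral of `1/|x|`. -/
lemma lintegral_ball_norm_sub_inv_le (R : ℝ) (y : ℂ) :
    ∫⁻ x in Metric.ball (0 : ℂ) R, ENNReal.ofReal ‖x - y‖⁻¹
      ≤ ∫⁻ x in Metric.ball (0 : ℂ) R, ENNReal.ofReal ‖x‖⁻¹ := by
  rcases le_or_gt R 0 with hR | hR
  · simp [Metric.ball_eq_empty.2 hR]
  set A := Metric.ball (0 : ℂ) R
  set B := Metric.ball (-y) R
  have hshift : ∫⁻ x in A, ENNReal.ofReal ‖x - y‖⁻¹ = ∫⁻ x in B, ENNReal.ofReal ‖x‖⁻¹ := by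
    have hmp : MeasurePreserving (fun x : ℂ => x - y) volume volume :=
      measurePreserving_sub_right volume y
    have hpre : (fun x : ℂ => x - y) ⁻¹' B = A := by
      ext x
      simp [A, B, dist_eq_norm]
    rw [← hpre]
    exact hmp.setLIntegral_comp_preimage (f := fun x : ℂ => ENNReal.ofReal ‖x‖⁻¹)
      measurableSet_ball (by fun_prop)
  have hvol : volume (B \ A) = volume (A \ B) := by
    have hA := measure_inter_add_sdiff (μ := volume) A (t := B) measurableSet_ball
    have hB := measure_inter_add_sdiff (μ := volume) B (t := A) measurableSet_ball
    have hAB : volume A = volume B := by simp [A, B, Complex.volume_ball]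
    rw [hAB, ← hB, Set.inter_comm] at hA
    have hfin : volume (B ∩ A) ≠ ⊤ :=
      (measure_mono Set.inter_subset_left |>.trans_lt measure_ball_lt_top).ne
    exact ((ENNReal.add_right_inj hfin).1 hA).symm
  have hout : ∫⁻ x in B \ A, ENNReal.ofReal ‖x‖⁻¹ ≤ ENNReal.ofReal R⁻¹ * volume (B \ A) := by
    rw [← setLIntegral_const]
    refine setLIntegral_mono measurable_const fun x hx => ENNReal.ofReal_le_ofReal ?_
    have : R ≤ ‖x‖ := by simpa [A] using hx.2
    gcongr
  have hin : ENNReal.ofReal R⁻¹ * volume (A \ B) ≤ ∫⁻ x in A \ B, ENNReal.ofReal ‖x‖⁻¹ := by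
    have h0 : volume ({(0 : ℂ)}) = 0 := measure_singleton _
    rw [← setLIntegral_const]
    refine setLIntegral_mono_ae (by fun_prop) ?_
    filter_upwards [compl_mem_ae_iff.2 h0] with x hx0 hx
    have hx0 : 0 < ‖x‖ := norm_pos_iff.2 hx0
    have : ‖x‖ < R := by simpa [A] using hx.1
    exact ENNReal.ofReal_le_ofReal (by gcongr)
  rw [hshift, ← lintegral_inter_add_sdiff _ B (measurableSet_ball : MeasurableSet A),
    ← lintegral_inter_add_sdiff _ A (measurableSet_ball : MeasurableSet B), Set.inter_comm]
  exact add_le_add_right (hout.trans (hvol ▸ hin)) _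

/-- The Coulomb potential of `ρ` on the plane, as an extended nonnegative number. -/
noncomputable def coulombPotential (ρ : ℂ → ℝ) (x : ℂ) : ENNReal :=
  ∫⁻ y, ENNReal.ofReal (ρ y) * ENNReal.ofReal ‖x - y‖⁻¹

lemma measurable_coulombPotential {ρ : ℂ → ℝ} (hρ : Measurable ρ) :
    Measurable (coulombPotential ρ) := by
  unfold coulombPotential
  refine Measurable.lintegral_prod_right' (f := fun p : ℂ × ℂ =>
    ENNReal.ofReal (ρ p.2) * ENNReal.ofReal ‖p.1 - p.2‖⁻¹) ?_
  fun_prop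

lemma lintegral_ball_coulombPotential_le {ρ : ℂ → ℝ} (hρ : Measurable ρ) {R : ℝ} (hR : 0 ≤ R) :
    ∫⁻ x in Metric.ball (0 : ℂ) R, coulombPotential ρ x
      ≤ (∫⁻ y, ENNReal.ofReal (ρ y)) * ENNReal.ofReal (2 * π * R) := by
  unfold coulombPotential
  rw [lintegral_lintegral_swap (by fun_prop), ← lintegral_mul_const _ (by fun_prop)]
  refine lintegral_mono fun y => ?_
  rw [lintegral_const_mul _ (by fun_prop), ← lintegral_ball_norm_inv hR]
  exact mul_le_mul_right (lintegral_ball_norm_sub_inv_le R y) _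

lemma ae_coulombPotential_lt_top {ρ : ℂ → ℝ} (hρ : Measurable ρ) (hint : Integrable ρ) :
    ∀ᵐ x, coulombPotential ρ x < ⊤ := by
  have hball : ∀ n : ℕ, ∀ᵐ x, x ∈ Metric.ball (0 : ℂ) n → coulombPotential ρ x < ⊤ := by
    intro n
    rw [← ae_restrict_iff' measurableSet_ball]
    refine ae_lt_top (measurable_coulombPotential hρ) ?_
    refine ne_top_of_le_ne_top ?_ (lintegral_ball_coulombPotential_le hρ n.cast_nonneg)
    exact ENNReal.mul_ne_top hint.lintegral_lt_top.ne ENNReal.ofReal_ne_top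
  filter_upwards [ae_all_iff.2 hball] with x hx
  obtain ⟨n, hn⟩ := exists_nat_gt ‖x‖
  exact hx n (by simpa using hn)

lemma integral_div_norm_sub_eq_toReal {ρ : ℂ → ℝ} (hρ : Measurable ρ) (hnonneg : ∀ x, 0 ≤ ρ x)
    (x : ℂ) : ∫ y, ρ y / ‖x - y‖ = (coulombPotential ρ x).toReal := by
  rw [integral_eq_lintegral_of_nonneg_ae
    (ae_of_all _ fun y => div_nonneg (hnonneg y) (norm_nonneg _))
    (by fun_prop : Measurable fun y => ρ y / ‖x - y‖).aestronglyMeasurable, coulombPotential]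
  congr 2
  ext y
  rw [← ENNReal.ofReal_mul (hnonneg y), div_eq_mul_inv]

lemma two_pi_mul_norm_inv_le_lintegral {a b : ℂ} (hab : ‖b‖ < ‖a‖) :
    ENNReal.ofReal (2 * π) * ENNReal.ofReal ‖a‖⁻¹
      ≤ ∫⁻ θ in Set.Ioc 0 (2 * π), ENNReal.ofReal ‖a - Complex.exp (θ * Complex.I) * b‖⁻¹ := by
  have hne : ∀ z ∈ closure (Metric.ball (0 : ℂ) |1|), a - z * b ≠ 0 := by
    intro z hz h
    have hz : ‖z‖ ≤ 1 := by
      simpa using Metric.closure_ball_subset_closedBall hz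
    rw [sub_eq_zero] at h
    rw [h, norm_mul] at hab
    nlinarith [norm_nonneg b]
  have hdiff : DiffContOnCl ℂ (fun z : ℂ => (a - z * b)⁻¹) (Metric.ball 0 |1|) := by
    refine DifferentiableOn.diffContOnCl fun z hz => ?_
    exact ((by fun_prop : DifferentiableAt ℂ (fun z => a - z * b) z).inv
      (hne z hz)).differentiableWithinAt
  have hmean := hdiff.circleAverage
  rw [circleAverage_def, intervalIntegral.integral_of_le (by positivity)] at hmean
  simp only [circleMap, Complex.ofReal_one, one_mul, zero_add, zero_mul, sub_zero] at hmean
  rw [inv_smul_eq_iff₀ (by positivity)] at hmean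
  have := enorm_integral_le_lintegral_enorm (μ := volume.restrict (Set.Ioc 0 (2 * π)))
    (fun θ : ℝ => (a - Complex.exp (θ * Complex.I) * b)⁻¹)
  rw [hmean, enorm_smul] at this
  simp only [← ofReal_norm, norm_inv, Real.norm_eq_abs] at this
  rwa [abs_of_pos (by positivity)] at this

/-- The average of `1/|x - y|` over all rotations of `y` is at least `1 / max |x| |y|`. -/
lemma two_pi_mul_max_norm_inv_le_lintegral {x y : ℂ} (hxy : ‖y‖ ≠ ‖x‖) :
    ENNReal.ofReal (2 * π) * ENNReal.ofReal (max ‖x‖ ‖y‖)⁻¹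
      ≤ ∫⁻ θ in Set.Ioc 0 (2 * π), ENNReal.ofReal ‖x - Complex.exp (θ * Complex.I) * y‖⁻¹ := by
  rcases lt_or_gt_of_ne hxy with h | h
  · rw [max_eq_left h.le]
    exact two_pi_mul_norm_inv_le_lintegral h
  · rw [max_eq_right h.le]
    have hconj := two_pi_mul_norm_inv_le_lintegral (a := starRingEnd ℂ y) (b := starRingEnd ℂ x)
      (by simpa using h)
    have hnorm : ∀ θ : ℝ, ‖starRingEnd ℂ y - Complex.exp (θ * Complex.I) * starRingEnd ℂ x‖
        = ‖x - Complex.exp (θ * Complex.I) * y‖ := by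
      intro θ
      have hexp : Complex.exp (θ * Complex.I) * starRingEnd ℂ (Complex.exp (θ * Complex.I)) = 1 := by
        rw [Complex.mul_conj']
        simp [Complex.norm_exp_ofReal_mul_I]
      have hfac : starRingEnd ℂ y - Complex.exp (θ * Complex.I) * starRingEnd ℂ x
          = -(Complex.exp (θ * Complex.I)
            * starRingEnd ℂ (x - Complex.exp (θ * Complex.I) * y)) := by
        rw [map_sub, map_mul]
        linear_combination (-starRingEnd ℂ y) * hexp
      rw [hfac, norm_neg, norm_mul, Complex.norm_exp_ofReal_mul_I, one_mul, RCLike.norm_conj]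
    simpa only [hnorm, RCLike.norm_conj] using hconj

/-- A radial charge distribution has at least the potential given by Newton's shell formula. -/
lemma lintegral_max_norm_inv_le_coulombPotential {ρ : ℂ → ℝ} (hρ : Measurable ρ)
    (hrad : ∀ x y : ℂ, ‖x‖ = ‖y‖ → ρ x = ρ y) (x : ℂ) :
    ∫⁻ y, ENNReal.ofReal (ρ y) * ENNReal.ofReal (max ‖x‖ ‖y‖)⁻¹ ≤ coulombPotential ρ x := by
  have hrot : ∀ θ : ℝ, ∫⁻ y, ENNReal.ofReal (ρ y) *
      ENNReal.ofReal ‖x - Complex.exp (θ * Complex.I) * y‖⁻¹ = coulombPotential ρ x := by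
    intro θ
    have hmp := (rotation (Circle.exp θ)).measurePreserving
    rw [coulombPotential, ← hmp.lintegral_comp
      (f := fun y => ENNReal.ofReal (ρ y) * ENNReal.ofReal ‖x - y‖⁻¹) (by fun_prop)]
    refine lintegral_congr fun y => ?_
    rw [rotation_apply, Circle.coe_exp, hrad (_ * y) y (by
      rw [norm_mul, Complex.norm_exp_ofReal_mul_I, one_mul])]
  have havg : ENNReal.ofReal (2 * π) * coulombPotential ρ x
      = ∫⁻ θ in Set.Ioc 0 (2 * π), ∫⁻ y, ENNReal.ofReal (ρ y) *
        ENNReal.ofReal ‖x - Complex.exp (θ * Complex.I) * y‖⁻¹ := by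
    simp_rw [hrot]
    simp [mul_comm]
  have h2π : ENNReal.ofReal (2 * π) ≠ 0 := by
    rw [ENNReal.ofReal_ne_zero_iff]
    positivity
  rw [← ENNReal.mul_le_mul_iff_right h2π ENNReal.ofReal_ne_top, havg,
    lintegral_lintegral_swap (by fun_prop), ← lintegral_const_mul _ (by fun_prop)]
  refine lintegral_mono_ae ?_
  have hsphere : volume {y : ℂ | ‖y‖ = ‖x‖} = 0 := by
    convert Measure.addHaar_sphere volume (0 : ℂ) ‖x‖ using 2
    ext y
    simp
  filter_upwards [compl_mem_ae_iff.2 hsphere] with y hy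
  rw [lintegral_const_mul _ (by fun_prop), mul_left_comm]
  gcongr
  exact two_pi_mul_max_norm_inv_le_lintegral hy

lemma one_le_integral_of_thomasFermi {ρ : ℂ → ℝ} (hρ : Measurable ρ) (hnonneg : ∀ x, 0 ≤ ρ x)
    (hint : Integrable ρ)
    (hTF : ∀ᵐ x : ℂ, x ≠ 0 → 2 * π * ρ x = max (‖x‖⁻¹ - ∫ y, ρ y / ‖x - y‖) 0) :
    1 ≤ ∫ x, ρ x := by
  set m := ∫ x, ρ x
  have hm : 0 ≤ m := integral_nonneg hnonneg
  have hM : ∫⁻ x, ENNReal.ofReal (ρ x) = ENNReal.ofReal m :=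
    (ofReal_integral_eq_lintegral_ofReal hint (ae_of_all _ hnonneg)).symm
  have hpt : ∀ᵐ x : ℂ, ENNReal.ofReal ‖x‖⁻¹
      ≤ coulombPotential ρ x + ENNReal.ofReal (2 * π) * ENNReal.ofReal (ρ x) := by
    filter_upwards [hTF] with x hx
    by_cases htop : coulombPotential ρ x = ⊤
    · simp [htop]
    by_cases hx0 : x = 0
    · simp [hx0]
    have hle := hx hx0 ▸ le_max_left (‖x‖⁻¹ - ∫ y, ρ y / ‖x - y‖) 0
    rw [integral_div_norm_sub_eq_toReal hρ hnonneg] at hle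
    rw [← ENNReal.ofReal_toReal htop, ← ENNReal.ofReal_mul (by positivity),
      ← ENNReal.ofReal_add ENNReal.toReal_nonneg (mul_nonneg (by positivity) (hnonneg x))]
    exact ENNReal.ofReal_le_ofReal (by linarith)
  have hball : ∀ R : ℝ, 0 ≤ R → R ≤ m * R + m := by
    intro R hR
    have hle : ENNReal.ofReal (2 * π * R) ≤ ENNReal.ofReal (2 * π * (m * R + m)) := calc
      _ = ∫⁻ x in Metric.ball (0 : ℂ) R, ENNReal.ofReal ‖x‖⁻¹ := (lintegral_ball_norm_inv hR).symm
      _ ≤ ∫⁻ x in Metric.ball (0 : ℂ) R,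
          (coulombPotential ρ x + ENNReal.ofReal (2 * π) * ENNReal.ofReal (ρ x)) :=
        lintegral_mono_ae (ae_restrict_of_ae hpt)
      _ = (∫⁻ x in Metric.ball (0 : ℂ) R, coulombPotential ρ x)
          + ENNReal.ofReal (2 * π) * ∫⁻ x in Metric.ball (0 : ℂ) R, ENNReal.ofReal (ρ x) := by
        rw [lintegral_add_left (measurable_coulombPotential hρ),
          lintegral_const_mul _ (by fun_prop)]
      _ ≤ ENNReal.ofReal m * ENNReal.ofReal (2 * π * R)
          + ENNReal.ofReal (2 * π) * ENNReal.ofReal m := by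
        rw [← hM]
        exact add_le_add (lintegral_ball_coulombPotential_le hρ hR)
          (mul_le_mul_right (setLIntegral_le_lintegral _ _) _)
      _ = _ := by
        rw [← ENNReal.ofReal_mul hm, ← ENNReal.ofReal_mul (by positivity),
          ← ENNReal.ofReal_add (by positivity) (by positivity)]
        congr 1
        ring
    rw [ENNReal.ofReal_le_ofReal_iff (by positivity)] at hle
    exact le_of_mul_le_mul_left hle (by positivity)
  by_contra! hlt
  have h1m : 0 < 1 - m := by linarith
  have hR := hball ((m + 1) / (1 - m)) (by positivity)
  have : (1 - m) * ((m + 1) / (1 - m)) = m + 1 := by field_simp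
  nlinarith

/-- The weighted tail `∫_{|y| > r} (1 - r/|y|) ρ(y) dy`. -/
noncomputable def tailMoment (ρ : ℂ → ℝ) (r : ℝ) : ℝ :=
  ∫ y, ρ y * (max (‖y‖ - r) 0 / ‖y‖)

lemma tailWeight_nonneg (r : ℝ) (y : ℂ) : 0 ≤ max (‖y‖ - r) 0 / ‖y‖ := by positivity

lemma tailWeight_le_one {r : ℝ} (hr : 0 ≤ r) (y : ℂ) : max (‖y‖ - r) 0 / ‖y‖ ≤ 1 :=
  div_le_one_of_le₀ (max_le (by linarith) (norm_nonneg _)) (norm_nonneg _)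

lemma norm_mul_tailWeight_le {ρ : ℂ → ℝ} (hnonneg : ∀ x, 0 ≤ ρ x) {r : ℝ} (hr : 0 ≤ r) (y : ℂ) :
    ‖ρ y * (max (‖y‖ - r) 0 / ‖y‖)‖ ≤ ρ y := by
  rw [Real.norm_of_nonneg (mul_nonneg (hnonneg y) (tailWeight_nonneg r y))]
  exact mul_le_of_le_one_right (hnonneg y) (tailWeight_le_one hr y)

lemma integrable_mul_tailWeight {ρ : ℂ → ℝ} (hρ : Measurable ρ) (hnonneg : ∀ x, 0 ≤ ρ x)
    (hint : Integrable ρ) {r : ℝ} (hr : 0 ≤ r) :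
    Integrable fun y => ρ y * (max (‖y‖ - r) 0 / ‖y‖) :=
  hint.mono' (by fun_prop : Measurable _).aestronglyMeasurable
    (ae_of_all _ (norm_mul_tailWeight_le hnonneg hr))

lemma tailMoment_nonneg {ρ : ℂ → ℝ} (hnonneg : ∀ x, 0 ≤ ρ x) (r : ℝ) : 0 ≤ tailMoment ρ r :=
  integral_nonneg fun y => mul_nonneg (hnonneg y) (tailWeight_nonneg r y)

lemma tailMoment_zero (ρ : ℂ → ℝ) : tailMoment ρ 0 = ∫ x, ρ x := by
  refine integral_congr_ae ?_
  filter_upwards [compl_mem_ae_iff.2 (measure_singleton (μ := volume) (0 : ℂ))] with y hy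
  have : ‖y‖ ≠ 0 := norm_ne_zero_iff.2 hy
  simp [this]

lemma tailMoment_antitoneOn {ρ : ℂ → ℝ} (hρ : Measurable ρ) (hnonneg : ∀ x, 0 ≤ ρ x)
    (hint : Integrable ρ) : AntitoneOn (tailMoment ρ) (Set.Ici 0) := by
  intro r hr s hs hrs
  refine integral_mono (integrable_mul_tailWeight hρ hnonneg hint hs)
    (integrable_mul_tailWeight hρ hnonneg hint hr) fun y => ?_
  have := hnonneg y
  dsimp only
  gcongr

lemma tailMoment_continuousOn {ρ : ℂ → ℝ} (hρ : Measurable ρ) (hnonneg : ∀ x, 0 ≤ ρ x)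
    (hint : Integrable ρ) : ContinuousOn (tailMoment ρ) (Set.Ici 0) := by
  refine continuousOn_of_dominated
    (fun r _ => (by fun_prop : Measurable _).aestronglyMeasurable)
    (fun r hr => ae_of_all _ (norm_mul_tailWeight_le hnonneg hr)) hint
    (ae_of_all _ fun y => ?_)
  exact Continuous.continuousOn (by fun_prop)

lemma tailMoment_tendsto_zero {ρ : ℂ → ℝ} (hρ : Measurable ρ) (hnonneg : ∀ x, 0 ≤ ρ x)
    (hint : Integrable ρ) : Filter.Tendsto (tailMoment ρ) Filter.atTop (nhds 0) := by
  have := tendsto_integral_filter_of_dominated_convergence (l := Filter.atTop)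
    (F := fun (r : ℝ) (y : ℂ) => ρ y * (max (‖y‖ - r) 0 / ‖y‖)) (f := fun _ : ℂ => (0 : ℝ)) ρ
    (Filter.Eventually.of_forall fun r => (by fun_prop : Measurable _).aestronglyMeasurable)
    ((Filter.eventually_ge_atTop 0).mono fun r hr =>
      ae_of_all _ (norm_mul_tailWeight_le hnonneg hr)) hint
    (ae_of_all _ fun y => tendsto_const_nhds.congr' ?_)
  · rwa [integral_zero] at this
  · filter_upwards [Filter.eventually_ge_atTop ‖y‖] with r hr
    simp [hr]

lemma tailMoment_le_integral_tail {ρ : ℂ → ℝ} (hρ : Measurable ρ) (hnonneg : ∀ x, 0 ≤ ρ x)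
    (hint : Integrable ρ) {r : ℝ} (hr : 0 ≤ r) :
    tailMoment ρ r ≤ ∫ x in {x : ℂ | r ≤ ‖x‖}, ρ x := by
  have hset : MeasurableSet {x : ℂ | r ≤ ‖x‖} := measurableSet_le measurable_const measurable_norm
  rw [← integral_indicator hset]
  refine integral_mono (integrable_mul_tailWeight hρ hnonneg hint hr) (hint.indicator hset)
    fun y => ?_
  by_cases hy : r ≤ ‖y‖
  · simpa [Set.indicator, hy] using
      mul_le_of_le_one_right (hnonneg y) (tailWeight_le_one hr y)
  · simp [Set.indicator, hy, le_of_not_ge hy]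

/-- Newton's shell comparison turns the Thomas–Fermi equation into a differential inequality for
the weighted tail. -/
lemma two_pi_mul_norm_mul_le_tailMoment {ρ : ℂ → ℝ} (hρ : Measurable ρ) (hnonneg : ∀ x, 0 ≤ ρ x)
    (hrad : ∀ x y : ℂ, ‖x‖ = ‖y‖ → ρ x = ρ y) (hint : Integrable ρ)
    (hTF : ∀ᵐ x : ℂ, x ≠ 0 → 2 * π * ρ x = max (‖x‖⁻¹ - ∫ y, ρ y / ‖x - y‖) 0) :
    ∀ᵐ x : ℂ, 2 * π * ‖x‖ * ρ x ≤ max (1 - (∫ y, ρ y) + tailMoment ρ ‖x‖) 0 := by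
  filter_upwards [hTF, ae_coulombPotential_lt_top hρ hint] with x hx hfin
  by_cases hx0 : x = 0
  · simp [hx0]
  have hr : 0 < ‖x‖ := norm_pos_iff.2 hx0
  have hweight : ∀ y : ℂ, ρ y * (max ‖x‖ ‖y‖)⁻¹
      = ‖x‖⁻¹ * (ρ y - ρ y * (max (‖y‖ - ‖x‖) 0 / ‖y‖)) := by
    intro y
    rcases le_total ‖y‖ ‖x‖ with h | h
    · rw [max_eq_left h, max_eq_right (by linarith)]
      ring
    · rw [max_eq_right h, max_eq_left (by linarith)]
      have : 0 < ‖y‖ := hr.trans_le h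
      field_simp
      ring
  have hintW := integrable_mul_tailWeight hρ hnonneg hint hr.le
  have hval : ∫ y, ρ y * (max ‖x‖ ‖y‖)⁻¹ = ‖x‖⁻¹ * ((∫ y, ρ y) - tailMoment ρ ‖x‖) := by
    simp_rw [hweight]
    rw [integral_const_mul, integral_sub hint hintW, tailMoment]
  have hshell : ‖x‖⁻¹ * ((∫ y, ρ y) - tailMoment ρ ‖x‖) ≤ (coulombPotential ρ x).toReal := by
    refine (ENNReal.ofReal_le_iff_le_toReal hfin.ne).1 ?_
    rw [← hval, ofReal_integral_eq_lintegral_ofReal]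
    · refine le_trans (le_of_eq ?_) (lintegral_max_norm_inv_le_coulombPotential hρ hrad x)
      exact lintegral_congr fun y => ENNReal.ofReal_mul (hnonneg y)
    · simp_rw [hweight]
      exact (hint.sub hintW).const_mul _
    · exact ae_of_all _ fun y => mul_nonneg (hnonneg y) (by positivity)
  have heq := hx hx0
  rw [integral_div_norm_sub_eq_toReal hρ hnonneg] at heq
  calc 2 * π * ‖x‖ * ρ x = ‖x‖ * (2 * π * ρ x) := by ring
    _ = ‖x‖ * max (‖x‖⁻¹ - (coulombPotential ρ x).toReal) 0 := by rw [heq]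
    _ ≤ ‖x‖ * max (‖x‖⁻¹ - ‖x‖⁻¹ * ((∫ y, ρ y) - tailMoment ρ ‖x‖)) 0 := by gcongr
    _ = max (1 - (∫ y, ρ y) + tailMoment ρ ‖x‖) 0 := by
      rw [mul_max_of_nonneg _ _ hr.le, mul_zero]
      congr 1
      field_simp
      ring

lemma integral_eq_one_of_thomasFermi {ρ : ℂ → ℝ} (hρ : Measurable ρ) (hnonneg : ∀ x, 0 ≤ ρ x)
    (hrad : ∀ x y : ℂ, ‖x‖ = ‖y‖ → ρ x = ρ y) (hint : Integrable ρ)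
    (hTF : ∀ᵐ x : ℂ, x ≠ 0 → 2 * π * ρ x = max (‖x‖⁻¹ - ∫ y, ρ y / ‖x - y‖) 0) :
    ∫ x, ρ x = 1 := by
  refine le_antisymm ?_ (one_le_integral_of_thomasFermi hρ hnonneg hint hTF)
  by_contra! hm
  set m := ∫ x, ρ x
  have hzero := tailMoment_tendsto_zero hρ hnonneg hint
  obtain ⟨b, hb, hb0⟩ := ((hzero.eventually_lt_const (sub_pos.2 hm)).and
    (Filter.eventually_ge_atTop 0)).exists
  obtain ⟨R, ⟨hR0, -⟩, hR⟩ := intermediate_value_Icc' hb0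
    ((tailMoment_continuousOn hρ hnonneg hint).mono Set.Icc_subset_Ici_self)
    (show m - 1 ∈ Set.Icc (tailMoment ρ b) (tailMoment ρ 0) by
      rw [tailMoment_zero]
      exact ⟨hb.le, by linarith⟩)
  have hvanish : tailMoment ρ R = 0 := by
    refine integral_eq_zero_of_ae ?_
    filter_upwards [two_pi_mul_norm_mul_le_tailMoment hρ hnonneg hrad hint hTF] with y hy
    rcases le_or_gt ‖y‖ R with h | h
    · simp [h]
    · have hanti := tailMoment_antitoneOn hρ hnonneg hint hR0 (hR0.trans h.le) h.le
      rw [max_eq_right (by linarith)] at hy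
      have hpos : 0 < 2 * π * ‖y‖ := by
        have := lt_of_le_of_lt hR0 h
        positivity
      have : ρ y = 0 := le_antisymm (by
        by_contra! hc
        nlinarith [mul_pos hpos hc]) (hnonneg y)
      simp [this]
  linarith

lemma integral_tent {r h : ℝ} (hh : 0 < h) (hhr : h < r) :
    ∫ s in Set.Ioi (0 : ℝ), max (h - |s - r|) 0 = h ^ 2 := by
  rw [setIntegral_eq_of_subset_of_forall_sdiff_eq_zero measurableSet_Ioi
    (s := Set.Ioc (r - h) (r + h)) (fun s hs => lt_of_le_of_lt (by linarith) hs.1),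
    ← intervalIntegral.integral_of_le (by linarith),
    ← intervalIntegral.integral_add_adjacent_intervals (b := r)
      (Continuous.intervalIntegrable (by fun_prop) _ _)
      (Continuous.intervalIntegrable (by fun_prop) _ _)]
  · have hleft : ∫ s in (r - h)..r, max (h - |s - r|) 0 = ∫ s in (r - h)..r, (h - r + s) := by
      refine intervalIntegral.integral_congr fun s hs => ?_
      rw [Set.uIcc_of_le (by linarith)] at hs
      rw [abs_of_nonpos (by linarith [hs.2]), max_eq_left (by linarith [hs.1])]
      ring
    have hright : ∫ s in r..(r + h), max (h - |s - r|) 0 = ∫ s in r..(r + h), (h + r - s) := by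
      refine intervalIntegral.integral_congr fun s hs => ?_
      rw [Set.uIcc_of_le (by linarith)] at hs
      rw [abs_of_nonneg (by linarith [hs.1]), max_eq_left (by linarith [hs.2])]
      ring
    rw [hleft, hright, intervalIntegral.integral_add (by simp) (by simp),
      intervalIntegral.integral_sub (f := fun _ => h + r) (g := fun s => s)
        (Continuous.intervalIntegrable (by fun_prop) _ _) (Continuous.intervalIntegrable (by fun_prop) _ _)]
    simp only [intervalIntegral.integral_const, integral_id, smul_eq_mul]
    ring
  · intro s hs
    refine max_eq_right ?_
    by_contra! hc
    have := abs_lt.1 (show |s - r| < h by linarith)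
    exact hs.2 ⟨by linarith, by linarith⟩

lemma second_difference_max_sub (r s : ℝ) {h : ℝ} (hh : 0 ≤ h) :
    max (s - (r + h)) 0 + max (s - (r - h)) 0 - 2 * max (s - r) 0 = max (h - |s - r|) 0 := by
  grind

lemma tailMoment_second_difference_le {ρ : ℂ → ℝ} (hρ : Measurable ρ) (hnonneg : ∀ x, 0 ≤ ρ x)
    (hint : Integrable ρ) {r h c : ℝ} (hh : 0 < h) (hhr : h < r)
    (hbound : ∀ᵐ y : ℂ, |‖y‖ - r| < h → 2 * π * ρ y ≤ c) :
    tailMoment ρ (r + h) + tailMoment ρ (r - h) - 2 * tailMoment ρ r ≤ c * h ^ 2 := by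
  have h1 := integrable_mul_tailWeight hρ hnonneg hint (r := r + h) (by linarith)
  have h2 := integrable_mul_tailWeight hρ hnonneg hint (r := r - h) (by linarith)
  have h3 := integrable_mul_tailWeight hρ hnonneg hint (r := r) (by linarith)
  have heq : tailMoment ρ (r + h) + tailMoment ρ (r - h) - 2 * tailMoment ρ r
      = ∫ y, ρ y * (max (h - |‖y‖ - r|) 0 / ‖y‖) := by
    simp only [tailMoment]
    rw [← integral_add h1 h2, ← integral_const_mul, ← integral_sub (by exact h1.add h2) (h3.const_mul 2)]
    refine integral_congr_ae (ae_of_all _ fun y => ?_)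
    dsimp only
    rw [← second_difference_max_sub r ‖y‖ hh.le]
    ring
  have hradial : ∀ s ∈ Set.Ioi (0 : ℝ), s * (c / (2 * π) * (max (h - |s - r|) 0 / s))
      = c / (2 * π) * max (h - |s - r|) 0 := by
    intro s hs
    have : s ≠ 0 := ne_of_gt hs
    field_simp
  have hintegral : ∫ y : ℂ, c / (2 * π) * (max (h - |‖y‖ - r|) 0 / ‖y‖) = c * h ^ 2 := by
    rw [integral_fun_norm_complex fun s => c / (2 * π) * (max (h - |s - r|) 0 / s),
      setIntegral_congr_fun measurableSet_Ioi hradial, integral_const_mul, integral_tent hh hhr]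
    field_simp
  have hintble : Integrable fun y : ℂ => c / (2 * π) * (max (h - |‖y‖ - r|) 0 / ‖y‖) := by
    rw [integrable_fun_norm_addHaar volume
      (f := fun s => c / (2 * π) * (max (h - |s - r|) 0 / s))]
    simp only [Complex.finrank_real_complex, Nat.add_one_sub_one, pow_one, smul_eq_mul]
    rw [integrableOn_congr_fun hradial measurableSet_Ioi]
    refine Integrable.const_mul ?_ _
    by_contra hni
    have := integral_undef hni
    rw [integral_tent hh hhr] at this
    exact (pow_pos hh 2).ne' this
  rw [heq, ← hintegral]
  refine integral_mono_of_nonneg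
    (ae_of_all _ fun y => mul_nonneg (hnonneg y) (by positivity)) hintble ?_
  filter_upwards [hbound] with y hy
  rcases lt_or_ge |‖y‖ - r| h with hlt | hge
  · have : ρ y ≤ c / (2 * π) := by
      rw [le_div_iff₀ (by positivity)]
      linarith [hy hlt]
    gcongr
  · rw [max_eq_right (by linarith)]
    simp

lemma hasDerivAt_exp_neg_two_mul_sqrt {s : ℝ} (hs : 0 < s) :
    HasDerivAt (fun s => exp (-2 * √s)) (-(exp (-2 * √s) / √s)) s := by
  refine ((hasDerivAt_sqrt hs.ne').const_mul (-2)).exp.congr_deriv ?_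
  have := sqrt_pos.2 hs
  field_simp

lemma hasDerivAt_neg_exp_neg_two_mul_sqrt_div {s : ℝ} (hs : 0 < s) :
    HasDerivAt (fun s => -(exp (-2 * √s) / √s))
      (exp (-2 * √s) / s + exp (-2 * √s) / (2 * s * √s)) s := by
  have hsq := sqrt_pos.2 hs
  refine ((hasDerivAt_exp_neg_two_mul_sqrt hs).div
    (hasDerivAt_sqrt hs.ne') hsq.ne').neg.congr_deriv ?_
  have h2 : √s ^ 2 = s := sq_sqrt hs.le
  field_simp
  simp only [h2]
  ring

/-- `exp (-2√r)` is a subsolution of `u'' = u / r`, in terms of second differences. -/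
lemma exp_neg_two_mul_sqrt_second_difference {r c : ℝ} (hr : 0 < r)
    (hc : c < exp (-2 * √r) / r) :
    ∀ᶠ h in nhdsWithin (0 : ℝ) (Set.Ioi 0),
      c * h ^ 2 ≤ exp (-2 * √(r + h)) + exp (-2 * √(r - h)) - 2 * exp (-2 * √r) := by
  have hcont : ContinuousAt (fun s => exp (-2 * √s) / s) r :=
    ContinuousAt.div (by fun_prop) continuousAt_id hr.ne'
  obtain ⟨δ, hδ, hδc⟩ := Metric.eventually_nhds_iff.1
    ((hcont.eventually_const_lt hc).and (eventually_gt_nhds hr))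
  filter_upwards [Ioo_mem_nhdsGT hδ] with h hh
  have hmem : ∀ s ∈ Set.Icc (r - h) (r + h), c < exp (-2 * √s) / s ∧ 0 < s := fun s hs =>
    hδc (by rw [Real.dist_eq, abs_lt]; constructor <;> linarith [hs.1, hs.2, hh.2])
  have hconv : ConvexOn ℝ (Set.Icc (r - h) (r + h))
      fun s => exp (-2 * √s) - c / 2 * s ^ 2 := by
    refine convexOn_of_hasDerivWithinAt2_nonneg (convex_Icc _ _)
      (f' := fun s => -(exp (-2 * √s) / √s) - c * s)
      (f'' := fun s => exp (-2 * √s) / s + exp (-2 * √s) / (2 * s * √s) - c)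
      (Continuous.continuousOn (by fun_prop)) ?_ ?_ ?_
    · intro s hs
      have hs := (hmem s (interior_subset hs)).2
      refine HasDerivAt.hasDerivWithinAt ?_
      refine ((hasDerivAt_exp_neg_two_mul_sqrt hs).sub
        ((hasDerivAt_pow 2 s).const_mul (c / 2))).congr_deriv ?_
      push_cast
      ring
    · intro s hs
      have hs := (hmem s (interior_subset hs)).2
      refine HasDerivAt.hasDerivWithinAt ?_
      refine ((hasDerivAt_neg_exp_neg_two_mul_sqrt_div hs).sub
        ((hasDerivAt_id s).const_mul c)).congr_deriv ?_
      ring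
    · intro s hs
      obtain ⟨hcs, hs⟩ := hmem s (interior_subset hs)
      have : 0 ≤ exp (-2 * √s) / (2 * s * √s) := by positivity
      linarith
  have hmid := hconv.2 (Set.left_mem_Icc.2 (by linarith [hh.1] : r - h ≤ r + h))
    (Set.right_mem_Icc.2 (by linarith [hh.1])) (by norm_num : (0 : ℝ) ≤ 1 / 2)
    (by norm_num : (0 : ℝ) ≤ 1 / 2) (by norm_num)
  simp only [smul_eq_mul] at hmid
  rw [show 1 / 2 * (r - h) + 1 / 2 * (r + h) = r by ring] at hmid
  nlinarith

/-- Maximum principle: a nonnegative supersolution of `u'' = u / r` on the half line with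
`u 0 = 1` dominates `exp (-2√r)`. -/
lemma exp_neg_two_mul_sqrt_le_of_second_difference_le {g : ℝ → ℝ}
    (hcont : ContinuousOn g (Set.Ici 0)) (hg0 : g 0 = 1) (hnonneg : ∀ r, 0 ≤ g r)
    (hsuper : ∀ r, 0 < r → ∀ c, g r / r < c → ∀ᶠ h in nhdsWithin (0 : ℝ) (Set.Ioi 0),
      g (r + h) + g (r - h) - 2 * g r ≤ c * h ^ 2)
    {r : ℝ} (hr : 0 ≤ r) : exp (-2 * √r) ≤ g r := by
  by_contra! hlt
  set w : ℝ → ℝ := fun s => exp (-2 * √s) - g s with hw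
  have hwr : 0 < w r := sub_pos.2 hlt
  have hwcont : ContinuousOn w (Set.Ici 0) :=
    (Continuous.continuousOn (by fun_prop)).sub hcont
  have htend : Filter.Tendsto (fun s => exp (-2 * √s)) Filter.atTop (nhds 0) :=
    tendsto_exp_atBot.comp (tendsto_sqrt_atTop.const_mul_atTop_of_neg (by norm_num))
  obtain ⟨b, hb⟩ := Filter.eventually_atTop.1 (htend.eventually_lt_const hwr)
  obtain ⟨p, ⟨hp0, -⟩, hpmax⟩ := isCompact_Icc.exists_isMaxOn
    (⟨r, hr, le_max_left r b⟩ : (Set.Icc 0 (max r b)).Nonempty)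
    (hwcont.mono Set.Icc_subset_Ici_self)
  have hmax : ∀ s, 0 ≤ s → w s ≤ w p := by
    intro s hs
    rcases le_total s (max r b) with h | h
    · exact hpmax ⟨hs, h⟩
    · have h1 := hb s ((le_max_right r b).trans h)
      have h2 : w r ≤ w p := hpmax ⟨hr, le_max_left r b⟩
      have h3 := hnonneg s
      simp only [hw] at h1 h2 ⊢
      linarith
  have hwp : 0 < w p := hwr.trans_le (hmax r hr)
  have hp : 0 < p := by
    refine lt_of_le_of_ne hp0 fun h => ?_
    simp [hw, ← h, hg0] at hwp
  have hgp : g p / p < exp (-2 * √p) / p := by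
    gcongr
    exact sub_pos.1 hwp
  obtain ⟨c₁, hc₁, hc⟩ := exists_between hgp
  obtain ⟨c₂, hc₁₂, hc₂⟩ := exists_between hc
  obtain ⟨h, ⟨hψ, hg⟩, hh0, hhp⟩ := (((exp_neg_two_mul_sqrt_second_difference hp hc₂).and
    (hsuper p hp c₁ hc₁)).and (Ioo_mem_nhdsGT hp)).exists
  have hplus := hmax (p + h) (by linarith)
  have hminus := hmax (p - h) (by linarith)
  simp only [hw] at hplus hminus
  nlinarith [mul_pos (sub_pos.2 hc₁₂) (pow_pos hh0 2)]

lemma exp_neg_two_mul_sqrt_le_tailMoment {ρ : ℂ → ℝ} (hρ : Measurable ρ) (hnonneg : ∀ x, 0 ≤ ρ x)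
    (hrad : ∀ x y : ℂ, ‖x‖ = ‖y‖ → ρ x = ρ y) (hint : Integrable ρ)
    (hTF : ∀ᵐ x : ℂ, x ≠ 0 → 2 * π * ρ x = max (‖x‖⁻¹ - ∫ y, ρ y / ‖x - y‖) 0)
    {r : ℝ} (hr : 0 ≤ r) : exp (-2 * √r) ≤ tailMoment ρ r := by
  have hone := integral_eq_one_of_thomasFermi hρ hnonneg hrad hint hTF
  have hgcont := tailMoment_continuousOn hρ hnonneg hint
  refine exp_neg_two_mul_sqrt_le_of_second_difference_le hgcont (by rw [tailMoment_zero, hone])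
    (tailMoment_nonneg hnonneg) (fun s hs c hc => ?_) hr
  have hcontAt : ContinuousAt (fun t => tailMoment ρ t / t) s :=
    (hgcont.continuousAt (Ici_mem_nhds hs)).div continuousAt_id hs.ne'
  obtain ⟨δ, hδ, hδc⟩ := Metric.eventually_nhds_iff.1 (hcontAt.eventually_lt_const hc)
  filter_upwards [Ioo_mem_nhdsGT (lt_min hδ hs)] with h hh
  have hhs : h < s := hh.2.trans_le (min_le_right _ _)
  refine tailMoment_second_difference_le hρ hnonneg hint hh.1 hhs ?_
  filter_upwards [two_pi_mul_norm_mul_le_tailMoment hρ hnonneg hrad hint hTF] with y hy hys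
  have hy0 : 0 < ‖y‖ := by linarith [(abs_lt.1 hys).1]
  have hlt := hδc (y := ‖y‖) (hys.trans (hh.2.trans_le (min_le_left _ _)))
  rw [hone, sub_self, zero_add, max_eq_left (tailMoment_nonneg hnonneg _)] at hy
  refine le_trans ?_ hlt.le
  rw [le_div_iff₀ hy0]
  linarith

/-- **Thomas–Fermi equation with zero chemical potential.** If `ρ : ℝ² → [0,∞)` is
measurable, radially symmetric, integrable and satisfies
`2πρ(x) = [|x|⁻¹ − (ρ ∗ |·|⁻¹)(x)]₊` a.e., then `∫ρ = 1`, the tails obey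
`∫_{|x| ≥ r} ρ ≥ e^{−2√r}` for all `r ≥ 0`, and the support of `ρ` is unbounded. -/
theorem tf_equation_zero_mu
    (ρ : EuclideanSpace ℝ (Fin 2) → ℝ)
    (hmeas : Measurable ρ)
    (hnonneg : ∀ x, 0 ≤ ρ x)
    (hrad : ∀ x y : EuclideanSpace ℝ (Fin 2), ‖x‖ = ‖y‖ → ρ x = ρ y)
    (hint : Integrable ρ)
    (hTF : ∀ᵐ x : EuclideanSpace ℝ (Fin 2), x ≠ 0 →
      2 * Real.pi * ρ x
        = max (‖x‖⁻¹ - (∫ y : EuclideanSpace ℝ (Fin 2), ρ y / ‖x - y‖)) 0) :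
    (∫ x : EuclideanSpace ℝ (Fin 2), ρ x) = 1 ∧
      (∀ r : ℝ, 0 ≤ r →
        Real.exp (-2 * Real.sqrt r)
          ≤ ∫ x in {x : EuclideanSpace ℝ (Fin 2) | r ≤ ‖x‖}, ρ x) ∧
      ¬ Bornology.IsBounded (Function.support ρ) := by
  set e := Complex.orthonormalBasisOneI.repr
  have hmp : MeasurePreserving e volume volume := e.measurePreserving
  have hemb : MeasurableEmbedding e := e.toHomeomorph.measurableEmbedding
  have hmeas' : Measurable (ρ ∘ e) := hmeas.comp hmp.measurable
  have hnonneg' : ∀ x, 0 ≤ (ρ ∘ e) x := fun x => hnonneg (e x)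
  have hrad' : ∀ x y : ℂ, ‖x‖ = ‖y‖ → (ρ ∘ e) x = (ρ ∘ e) y := fun x y hxy =>
    hrad _ _ (by simpa using hxy)
  have hint' : Integrable (ρ ∘ e) := (hmp.integrable_comp_emb hemb).2 hint
  have hTF' : ∀ᵐ x : ℂ, x ≠ 0 →
      2 * π * (ρ ∘ e) x = max (‖x‖⁻¹ - ∫ y, (ρ ∘ e) y / ‖x - y‖) 0 := by
    filter_upwards [hmp.quasiMeasurePreserving.ae hTF] with x hx hx0
    have hx := hx (by simpa using hx0)
    rw [← hmp.integral_comp hemb] at hx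
    simpa [← map_sub] using hx
  have htail : ∀ r : ℝ, 0 ≤ r →
      exp (-2 * √r) ≤ ∫ x in {x : EuclideanSpace ℝ (Fin 2) | r ≤ ‖x‖}, ρ x := by
    intro r hr
    rw [← hmp.setIntegral_preimage_emb hemb]
    simpa using (exp_neg_two_mul_sqrt_le_tailMoment hmeas' hnonneg' hrad' hint' hTF' hr).trans
      (tailMoment_le_integral_tail hmeas' hnonneg' hint' hr)
  refine ⟨?_, htail, fun hbdd => ?_⟩
  · rw [← hmp.integral_comp hemb]
    exact integral_eq_one_of_thomasFermi hmeas' hnonneg' hrad' hint' hTF'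
  · obtain ⟨C, hC0, hC⟩ := hbdd.exists_pos_norm_le
    have hzero : ∫ x in {x : EuclideanSpace ℝ (Fin 2) | C + 1 ≤ ‖x‖}, ρ x = 0 := by
      refine setIntegral_eq_zero_of_forall_eq_zero fun x hx => ?_
      by_contra hne
      have : C + 1 ≤ ‖x‖ := hx
      linarith [hC x hne]
    have := htail (C + 1) (by linarith)
    rw [hzero] at this
    exact (exp_pos _).not_ge this
end

section
/- Let g : [0, ∞) → ℝ be continuous, twice differentiable on (0, ∞), with g(0) = 1, lim_{r→∞} g(r) = 0, and suppose that r g''(r) ≤ g(r) for all r > 0. Then g(r) ≥ e^{−2√r} for all r ≥ 0. -/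
open Real Filter Topology

/-- The second derivative is nonnegative at a local minimum. -/
lemma IsLocalMin.nonneg_of_hasDerivAt_hasDerivAt {f f' : ℝ → ℝ} {c x : ℝ}
    (hmin : IsLocalMin f x) (hf : ∀ᶠ y in 𝓝 x, HasDerivAt f (f' y) y)
    (hf' : HasDerivAt f' c x) : 0 ≤ c := by
  by_contra! hc
  have hderiv : deriv f =ᶠ[𝓝 x] f' := hf.mono fun y hy => hy.deriv
  have hsecond : deriv (deriv f) x = c := hderiv.deriv_eq.trans hf'.deriv
  have hmax : IsLocalMax f x :=
    isLocalMax_of_deriv_deriv_neg (hsecond ▸ hc) hmin.deriv_eq_zero hf.self_of_nhds.continuousAt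
  have hconst : f =ᶠ[𝓝 x] fun _ => f x := by
    filter_upwards [hmin, hmax] with y h₁ h₂ using le_antisymm h₂ h₁
  have hzero : deriv (deriv f) x = 0 := by
    rw [hconst.deriv.deriv_eq]
    simp
  linarith

lemma hasDerivAt_exp_neg_two_mul_sqrt_s18 {r : ℝ} (hr : 0 < r) :
    HasDerivAt (fun r => Real.exp (-2 * Real.sqrt r))
      (-(Real.exp (-2 * Real.sqrt r) / Real.sqrt r)) r := by
  have hs : Real.sqrt r ≠ 0 := (Real.sqrt_pos.2 hr).ne'
  refine ((Real.hasDerivAt_sqrt hr.ne').const_mul (-2)).exp.congr_deriv ?_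
  field_simp

lemma hasDerivAt_deriv_exp_neg_two_mul_sqrt {r : ℝ} (hr : 0 < r) :
    HasDerivAt (fun r => -(Real.exp (-2 * Real.sqrt r) / Real.sqrt r))
      (Real.exp (-2 * Real.sqrt r) * (1 + 1 / (2 * Real.sqrt r)) / r) r := by
  have hs : Real.sqrt r ≠ 0 := (Real.sqrt_pos.2 hr).ne'
  have hsq : Real.sqrt r ^ 2 = r := Real.sq_sqrt hr.le
  refine ((hasDerivAt_exp_neg_two_mul_sqrt_s18 hr).fun_div
    (Real.hasDerivAt_sqrt hr.ne') hs).fun_neg.congr_deriv ?_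
  rw [hsq]
  field_simp
  ring

lemma tendsto_exp_neg_two_mul_sqrt_atTop :
    Tendsto (fun r => Real.exp (-2 * Real.sqrt r)) atTop (𝓝 0) :=
  Real.tendsto_exp_atBot.comp
    (Real.tendsto_sqrt_atTop.const_mul_atTop_of_neg (by norm_num))

/-- A function continuous on `[0, ∞)` that is nonnegative at `0` and tends to `0` at infinity
attains a negative local minimum in `(0, ∞)` as soon as it takes a negative value there. -/
lemma exists_isLocalMin_neg_of_tendsto_zero {h : ℝ → ℝ} (hcont : ContinuousOn h (Set.Ici 0))
    (h0 : 0 ≤ h 0) (hlim : Tendsto h atTop (𝓝 0)) {r : ℝ} (hr : 0 ≤ r) (hneg : h r < 0) :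
    ∃ x, 0 < x ∧ h x < 0 ∧ IsLocalMin h x := by
  obtain ⟨M, hM, hrM⟩ := ((hlim.eventually_const_lt hneg).and (eventually_ge_atTop r)).exists
  obtain ⟨x, hx, hmin⟩ := isCompact_Icc.exists_isMinOn ⟨r, hr, hrM⟩
    (hcont.mono Set.Icc_subset_Ici_self)
  have hxr : h x ≤ h r := hmin ⟨hr, hrM⟩
  have hx0 : 0 < x := hx.1.lt_of_ne (by rintro rfl; linarith)
  have hxM : x < M := hx.2.lt_of_ne (by rintro rfl; linarith)
  exact ⟨x, hx0, hxr.trans_lt hneg, hmin.isLocalMin (Icc_mem_nhds hx0 hxM)⟩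

/-- **Comparison principle for the Thomas–Fermi tail estimate.** Let `g : [0,∞) → ℝ` be
continuous, twice differentiable on `(0,∞)` (with first and second derivatives `g'`, `g''`),
with `g(0) = 1`, `g(r) → 0` as `r → ∞`, and `r g''(r) ≤ g(r)` for all `r > 0`.
Then `g(r) ≥ e^{−2√r}` for all `r ≥ 0`. -/
theorem tf_tail_comparison_principle
    (g g' g'' : ℝ → ℝ)
    (hcont : ContinuousOn g (Set.Ici 0))
    (hderiv : ∀ r : ℝ, 0 < r → HasDerivAt g (g' r) r)
    (hderiv2 : ∀ r : ℝ, 0 < r → HasDerivAt g' (g'' r) r)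
    (h0 : g 0 = 1)
    (hlim : Filter.Tendsto g Filter.atTop (nhds 0))
    (hineq : ∀ r : ℝ, 0 < r → r * g'' r ≤ g r) :
    ∀ r : ℝ, 0 ≤ r → g r ≥ Real.exp (-2 * Real.sqrt r) := by
  intro r hr
  by_contra! hlt
  obtain ⟨x, hx, hneg, hmin⟩ :=
    exists_isLocalMin_neg_of_tendsto_zero
      (h := fun r => g r - Real.exp (-2 * Real.sqrt r))
      (hcont.sub (by fun_prop)) (by simp [h0])
      (by simpa using hlim.sub tendsto_exp_neg_two_mul_sqrt_atTop) hr (sub_neg.2 hlt)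
  have hsecond := hmin.nonneg_of_hasDerivAt_hasDerivAt
    ((eventually_gt_nhds hx).mono fun y hy =>
      (hderiv y hy).sub (hasDerivAt_exp_neg_two_mul_sqrt_s18 hy))
    ((hderiv2 x hx).sub (hasDerivAt_deriv_exp_neg_two_mul_sqrt hx))
  have hpos : 0 < Real.exp (-2 * Real.sqrt x) * (1 / (2 * Real.sqrt x)) := by positivity
  have hmul := mul_nonneg hx.le hsecond
  rw [mul_sub, mul_div_cancel₀ _ hx.ne'] at hmul
  linarith [hineq x hx]
end

section
/- Let μ ≥ 0 and let ρ : ℝ² → [0, ∞) be measurable, radially symmetric, with ∫_{ℝ²} ρ = λ, satisfying the Thomas–Fermi equation 2πρ(x) = [ |x|^{-1} − (ρ ∗ |·|^{-1})(x) − μ ]_+ for a.e. x ≠ 0. Then for a.e. x ≠ 0 one has the two-sided bound 0 ≤ |x|^{-1} − 2πρ(x) ≤ 2√(2λ) |x|^{-1/2} + 3 + μ. -/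
open Real MeasureTheory

/-- The radial profile `s ↦ s⁻¹` truncated to `s < R`. -/
noncomputable def truncInv (R s : ℝ) : ℝ := if s < R then s⁻¹ else 0

lemma truncInv_nonneg (R : ℝ) {s : ℝ} (hs : 0 ≤ s) : 0 ≤ truncInv R s := by
  unfold truncInv
  split_ifs <;> positivity

lemma mul_truncInv_of_pos {R s : ℝ} (hs : 0 < s) :
    s ^ (2 - 1) • truncInv R s = (Set.Iio R).indicator (fun _ => (1 : ℝ)) s := by
  by_cases h : s < R
  · simp [truncInv, h, hs.ne']
  · simp [truncInv, h]

lemma integrable_truncInv_norm (R : ℝ) :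
    Integrable (fun x : EuclideanSpace ℝ (Fin 2) => truncInv R ‖x‖) := by
  rw [integrable_fun_norm_addHaar, finrank_euclideanSpace_fin,
    integrableOn_congr_fun (fun s (hs : s ∈ Set.Ioi 0) => mul_truncInv_of_pos hs)
      measurableSet_Ioi,
    IntegrableOn, integrable_indicator_iff measurableSet_Iio, IntegrableOn,
    Measure.restrict_restrict measurableSet_Iio, Set.inter_comm, Set.Ioi_inter_Iio]
  exact integrableOn_const (by simp)

lemma integral_truncInv_norm {R : ℝ} (hR : 0 ≤ R) :
    ∫ x : EuclideanSpace ℝ (Fin 2), truncInv R ‖x‖ = 2 * π * R := by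
  rw [integral_fun_norm_addHaar, finrank_euclideanSpace_fin,
    setIntegral_congr_fun measurableSet_Ioi (fun s hs => mul_truncInv_of_pos hs),
    integral_indicator measurableSet_Iio, Measure.restrict_restrict measurableSet_Iio,
    Set.inter_comm, Set.Ioi_inter_Iio]
  simp [Measure.real, hR, pi_nonneg]
  ring

/-- Pointwise splitting of the Coulomb kernel, where `a`, `b`, `r` are the lengths of the sides of
a triangle. -/
lemma div_le_div_add_truncInv {a b r R t : ℝ} (ha : 0 < a) (hb : 0 ≤ b) (hr : 0 < r) (hR : 0 < R)
    (hrab : r ≤ a + b) (ht : 0 ≤ t) (hta : 2 * π * t ≤ a⁻¹) :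
    t / b ≤ t / R + (2 * π * r)⁻¹ * (truncInv R a + truncInv R b) := by
  have hc : 0 < (2 * π * r)⁻¹ := by positivity
  rcases hb.eq_or_lt with rfl | hb
  · have := truncInv_nonneg R ha.le
    have := truncInv_nonneg R le_rfl
    rw [div_zero]
    positivity
  rcases le_or_gt R b with hbR | hbR
  · have h1 := truncInv_nonneg R ha.le
    have h2 := truncInv_nonneg R hb.le
    have : t / b ≤ t / R := div_le_div_of_nonneg_left ht hR hbR
    have : 0 ≤ (2 * π * r)⁻¹ * (truncInv R a + truncInv R b) := by positivity
    linarith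
  have key : a⁻¹ * (b⁻¹ - R⁻¹) ≤ r⁻¹ * (truncInv R a + truncInv R b) := by
    rcases lt_or_ge a R with haR | haR
    · have : a⁻¹ * b⁻¹ ≤ r⁻¹ * (a⁻¹ + b⁻¹) := by
        rw [show r⁻¹ * (a⁻¹ + b⁻¹) = (a + b) / r * (a⁻¹ * b⁻¹) by field_simp; ring]
        exact le_mul_of_one_le_left (by positivity) ((one_le_div hr).2 hrab)
      have : 0 ≤ a⁻¹ * R⁻¹ := by positivity
      simp only [truncInv, haR, hbR, if_true]
      linarith
    · simp only [truncInv, not_lt.2 haR, hbR, if_true, if_false, zero_add]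
      rw [show a⁻¹ * (b⁻¹ - R⁻¹) = (R - b) / (a * b * R) by field_simp, ← mul_inv,
        inv_eq_one_div, div_le_div_iff₀ (by positivity) (by positivity)]
      have h1 : r * (R - b) ≤ (a + b) * (R - b) :=
        mul_le_mul_of_nonneg_right hrab (by linarith)
      have h2 : (a + b) * (R - b) ≤ a * R := by nlinarith
      nlinarith
  have hd : 0 ≤ b⁻¹ - R⁻¹ := sub_nonneg.2 (inv_anti₀ hb hbR.le)
  have h := (mul_le_mul_of_nonneg_right hta hd).trans key
  have h' := mul_le_mul_of_nonneg_left h (by positivity : 0 ≤ (2 * π)⁻¹)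
  have e : (2 * π)⁻¹ * (2 * π * t * (b⁻¹ - R⁻¹)) = t / b - t / R := by
    field_simp
  rw [e, ← mul_assoc, ← mul_inv] at h'
  linarith

/-- Coulomb potential estimate for densities on the plane dominated by `(2π|y|)⁻¹`. -/
lemma coulomb_potential_le {ρ : EuclideanSpace ℝ (Fin 2) → ℝ} (hnonneg : ∀ x, 0 ≤ ρ x)
    (hint : Integrable ρ) (hle : ∀ᵐ y, y ≠ 0 → 2 * π * ρ y ≤ ‖y‖⁻¹)
    {x : EuclideanSpace ℝ (Fin 2)} (hx : x ≠ 0) :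
    ∫ y, ρ y / ‖x - y‖ ≤ 2 * √(2 * ∫ y, ρ y) * ‖x‖ ^ (-(1 / 2) : ℝ) := by
  have hr : 0 < ‖x‖ := norm_pos_iff.2 hx
  rcases (integral_nonneg (μ := volume) (f := ρ) hnonneg).eq_or_lt with h0 | hlam
  · have hz : ρ =ᵐ[volume] 0 := (integral_eq_zero_iff_of_nonneg hnonneg hint).1 h0.symm
    have : ∫ y, ρ y / ‖x - y‖ = 0 :=
      integral_eq_zero_of_ae (hz.mono fun y hy => by simp [hy])
    rw [this]
    positivity
  have hadd (R : ℝ) (hR : 0 < R) :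
      ∫ y, ρ y / ‖x - y‖ ≤ (∫ y, ρ y) / R + 2 * R / ‖x‖ := by
    have i1 := integrable_truncInv_norm R
    have i2 : Integrable fun y => truncInv R ‖x - y‖ := i1.comp_sub_left x
    have i3 : Integrable fun y =>
        (2 * π * ‖x‖)⁻¹ * (truncInv R ‖y‖ + truncInv R ‖x - y‖) := (i1.add i2).const_mul _
    calc ∫ y, ρ y / ‖x - y‖
        ≤ ∫ y, (ρ y / R + (2 * π * ‖x‖)⁻¹ * (truncInv R ‖y‖ + truncInv R ‖x - y‖)) := by
          refine integral_mono_of_nonneg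
            (.of_forall fun y => div_nonneg (hnonneg y) (norm_nonneg _))
            ((hint.div_const R).add i3) ?_
          filter_upwards [hle, Measure.ae_ne volume 0] with y hy hy0
          refine div_le_div_add_truncInv (norm_pos_iff.2 hy0) (norm_nonneg _) hr hR ?_
            (hnonneg y) (hy hy0)
          simpa using norm_add_le y (x - y)
      _ = (∫ y, ρ y) / R + 2 * R / ‖x‖ := by
          rw [integral_add (hint.div_const R) i3, integral_div,
            integral_const_mul, integral_add i1 i2,
            integral_sub_left_eq_self (fun y => truncInv R ‖y‖) volume x,
            integral_truncInv_norm hR.le]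
          field_simp
          ring
  set lam := ∫ y, ρ y
  set s := √(2 * lam) with hs
  set q := √‖x‖ with hq
  have hs0 : 0 < s := by positivity
  have hq0 : 0 < q := by positivity
  have hs2 : s ^ 2 = 2 * lam := sq_sqrt (by positivity)
  have hq2 : q ^ 2 = ‖x‖ := sq_sqrt hr.le
  have e : ‖x‖ ^ (-(1 / 2) : ℝ) = q⁻¹ := by rw [rpow_neg hr.le, ← sqrt_eq_rpow]
  refine (hadd (s * q / 2) (by positivity)).trans_eq ?_
  rw [e, ← hq2, show lam = s ^ 2 / 2 by linarith]
  field_simp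
  ring

/-- **Two-sided bound from the Thomas–Fermi equation.** If `μ ≥ 0` and `ρ : ℝ² → [0,∞)`
is measurable, radially symmetric, with `∫ρ = λ`, and satisfies
`2πρ(x) = [|x|⁻¹ − (ρ ∗ |·|⁻¹)(x) − μ]₊` a.e., then for a.e. `x ≠ 0`,
`0 ≤ |x|⁻¹ − 2πρ(x) ≤ 2√(2λ)|x|^{-1/2} + 3 + μ`. -/
theorem tf_equation_two_sided_bound
    (μ lam : ℝ) (hμ : 0 ≤ μ)
    (ρ : EuclideanSpace ℝ (Fin 2) → ℝ)
    (hmeas : Measurable ρ)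
    (hnonneg : ∀ x, 0 ≤ ρ x)
    (hrad : ∀ x y : EuclideanSpace ℝ (Fin 2), ‖x‖ = ‖y‖ → ρ x = ρ y)
    (hint : Integrable ρ)
    (hmass : (∫ x : EuclideanSpace ℝ (Fin 2), ρ x) = lam)
    (hTF : ∀ᵐ x : EuclideanSpace ℝ (Fin 2), x ≠ 0 →
      2 * Real.pi * ρ x
        = max (‖x‖⁻¹ - (∫ y : EuclideanSpace ℝ (Fin 2), ρ y / ‖x - y‖) - μ) 0) :
    ∀ᵐ x : EuclideanSpace ℝ (Fin 2), x ≠ 0 →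
      0 ≤ ‖x‖⁻¹ - 2 * Real.pi * ρ x ∧
        ‖x‖⁻¹ - 2 * Real.pi * ρ x
          ≤ 2 * Real.sqrt (2 * lam) * ‖x‖ ^ (-(1/2) : ℝ) + 3 + μ := by
  have hV (x : EuclideanSpace ℝ (Fin 2)) : 0 ≤ ∫ y, ρ y / ‖x - y‖ :=
    integral_nonneg fun y => div_nonneg (hnonneg y) (norm_nonneg _)
  have hle : ∀ᵐ y : EuclideanSpace ℝ (Fin 2), y ≠ 0 → 2 * π * ρ y ≤ ‖y‖⁻¹ := by
    filter_upwards [hTF] with y hy hy0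
    rw [hy hy0]
    exact max_le (by linarith [hV y]) (by positivity)
  filter_upwards [hTF, hle] with x hx hx' hx0
  refine ⟨sub_nonneg.2 (hx' hx0), ?_⟩
  have h1 := coulomb_potential_le hnonneg hint hle hx0
  rw [hmass] at h1
  have h2 := le_max_left (‖x‖⁻¹ - (∫ y, ρ y / ‖x - y‖) - μ) 0
  rw [← hx hx0] at h2
  linarith
end
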